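/- arXiv:1601.04370 — 3 statements merged into one kernel-verified Lean document; each statement's English description precedes it below -/
import Mathlib

section
/- For the sets J and K associated with d = 11 and v = (1,−1,−1,1,−1,1,1,1,1,−1,−1), the following congruences hold modulo 2 for every n ≥ 1: X_{11n} ≡ U_n; Y_{11n} ≡ U_n + V_n; X_{11n+1} ≡ W_{n+1}(U_n + V_n); Y_{11n+1} ≡ V_nW_{n+1}; X_{11n+2} ≡ U_nW_{n+1}; Y_{11n+2} ≡ W_{n+1}(U_n + V_n); X_{11n+3} ≡ W_{n+1}(U_n + V_n); Y_{11n+3} ≡ V_nW_{n+1}; X_{11n+4} ≡ V_nW_{n+1}; Y_{11n+4} ≡ U_nW_{n+1}; X_{11n+5} ≡ U_nW_{n+1}; Y_{11n+5} ≡ W_{n+1}(U_n + V_n); X_{11n+6} ≡ U_{n+1}W_{n+1}; Y_{11n+6} ≡ W_{n+1}(U_{n+1} + V_{n+1}); X_{11n+7} ≡ V_{n+1}W_{n+1}; Y_{11n+7} ≡ U_{n+1}W_{n+1}; X_{11n+8} ≡ W_{n+1}(U_{n+1} + V_{n+1}); Y_{11n+8} ≡ V_{n+1}W_{n+1}; X_{11n+9}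 ≡ U_{n+1}W_{n+1}; Y_{11n+9} ≡ W_{n+1}(U_{n+1} + V_{n+1}); X_{11n+10} ≡ W_{n+1}(U_{n+1} + V_{n+1}); Y_{11n+10} ≡ V_{n+1}W_{n+1}; Z_{11n} ≡ W_n(U_n + V_n + U_nV_n); Z_{11n+i} ≡ W_{n+1}(U_n + V_n + U_nV_n) for i = 1,2,3,4,5; Z_{11n+6} ≡ W_{n+1}; Z_{11n+i} ≡ W_{n+1}(U_{n+1} + V_{n+1} + U_{n+1}V_{n+1}) for i = 7,8,9,10. -/
def P11 : Set ℕ := {1, 3, 4, 5, 9}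
def Q11 : Set ℕ := {2, 6, 7, 8, 10}

/-- `J` for `d = 11`, `v = (1,−1,−1,1,−1,1,1,1,1,−1,−1)`. -/
def J11 : Set ℕ :=
  {t | ∃ n k p : ℕ, p ∈ P11 ∧ t + 1 = (11 * n + p) * 11 ^ (2 * k)} ∪
  {t | ∃ n k q : ℕ, q ∈ Q11 ∧ t + 1 = (11 * n + q) * 11 ^ (2 * k + 1)}

/-- `K` for `d = 11`, `v = (1,−1,−1,1,−1,1,1,1,1,−1,−1)`. -/
def K11 : Set ℕ :=
  {t | ∃ n k q : ℕ, q ∈ Q11 ∧ t + 1 = (11 * n + q) * 11 ^ (2 * k)} ∪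
  {t | ∃ n k p : ℕ, p ∈ P11 ∧ t + 1 = (11 * n + p) * 11 ^ (2 * k + 1)}

/-- The number of permutations `σ` of `{0,…,m−1}` with `i + σ(i) ∈ S` for all
`i ≠ l`. -/
noncomputable def permCount (S : Set ℕ) (m l : ℕ) : ℕ :=
  Nat.card {σ : Equiv.Perm (Fin m) //
    ∀ i : Fin m, (i : ℕ) ≠ l → ((i : ℕ) + ((σ i : Fin m) : ℕ)) ∈ S}

noncomputable def X (n : ℕ) : ℕ := ∑ i ∈ Finset.range n, permCount J11 n i
noncomputable def Y (n : ℕ) : ℕ := permCount J11 n n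
noncomputable def Z (n : ℕ) : ℕ := permCount J11 n (n - 1)
noncomputable def U (n : ℕ) : ℕ := ∑ i ∈ Finset.range n, permCount K11 n i
noncomputable def V (n : ℕ) : ℕ := permCount K11 n n
noncomputable def W (n : ℕ) : ℕ := permCount K11 n (n - 1)

namespace ApwenianEleven

open Finset Matrix

section Indicator

/-- The indicator of a set of naturals, valued in `ZMod 2`. -/
noncomputable def ind (S : Set ℕ) (n : ℕ) : ZMod 2 := S.indicator 1 n

lemma ind_congr {S T : Set ℕ} {a b : ℕ} (h : a ∈ S ↔ b ∈ T) : ind S a = ind T b := by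
  classical
  simp only [ind, Set.indicator_apply, h, Pi.one_apply]

/-- The common shape of `J11` and `K11`. -/
def residueSet (A B : Set ℕ) : Set ℕ :=
  {t | ∃ n k p : ℕ, p ∈ A ∧ t + 1 = (11 * n + p) * 11 ^ (2 * k)} ∪
  {t | ∃ n k q : ℕ, q ∈ B ∧ t + 1 = (11 * n + q) * 11 ^ (2 * k + 1)}

lemma eleven_dvd_mul_pow (a k : ℕ) : 11 ∣ a * 11 ^ (k + 1) := ⟨a * 11 ^ k, by ring⟩

lemma mem_residueSet_of_lt {A B : Set ℕ} (hA : ∀ p ∈ A, 0 < p ∧ p < 11) {x i : ℕ} (hi : i < 10) :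
    11 * x + i ∈ residueSet A B ↔ i + 1 ∈ A := by
  constructor
  · rintro (⟨n, k, p, hp, h⟩ | ⟨n, k, p, hp, h⟩)
    · rcases k with _ | k
      · have := hA p hp
        obtain rfl : p = i + 1 := by simp at h; omega
        exact hp
      · have := eleven_dvd_mul_pow (11 * n + p) (2 * k + 1)
        rw [show 2 * (k + 1) = 2 * k + 1 + 1 by ring] at h
        omega
    · have := eleven_dvd_mul_pow (11 * n + p) (2 * k)
      omega
  · exact fun h => Or.inl ⟨x, 0, i + 1, h, by simp; ring⟩

lemma mem_residueSet_ten {A B : Set ℕ} (hA : ∀ p ∈ A, 0 < p ∧ p < 11) {x : ℕ} :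
    11 * x + 10 ∈ residueSet A B ↔ x ∈ residueSet B A := by
  constructor
  · rintro (⟨n, k, p, hp, h⟩ | ⟨n, k, p, hp, h⟩)
    · rcases k with _ | k
      · have := hA p hp
        simp at h; omega
      · refine Or.inr ⟨n, k, p, hp, ?_⟩
        have : 11 * (x + 1) = 11 * ((11 * n + p) * 11 ^ (2 * k + 1)) := by
          rw [show 11 * (x + 1) = 11 * x + 10 + 1 by ring, h]; ring
        omega
    · refine Or.inl ⟨n, k, p, hp, ?_⟩
      have : 11 * (x + 1) = 11 * ((11 * n + p) * 11 ^ (2 * k)) := by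
        rw [show 11 * (x + 1) = 11 * x + 10 + 1 by ring, h]; ring
      omega
  · rintro (⟨n, k, p, hp, h⟩ | ⟨n, k, p, hp, h⟩)
    · refine Or.inr ⟨n, k, p, hp, ?_⟩
      rw [show 11 * x + 10 + 1 = 11 * (x + 1) by ring, h]; ring
    · refine Or.inl ⟨n, k + 1, p, hp, ?_⟩
      rw [show 11 * x + 10 + 1 = 11 * (x + 1) by ring, h]; ring

lemma P11_bounds : ∀ p ∈ P11, 0 < p ∧ p < 11 := by
  intro p hp
  simp only [P11, Set.mem_insert_iff, Set.mem_singleton_iff] at hp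
  omega

lemma Q11_bounds : ∀ p ∈ Q11, 0 < p ∧ p < 11 := by
  intro p hp
  simp only [Q11, Set.mem_insert_iff, Set.mem_singleton_iff] at hp
  omega

lemma mem_J11_iff (t : ℕ) : t ∈ J11 ↔ t ∉ K11 := by
  change t ∈ residueSet P11 Q11 ↔ t ∉ residueSet Q11 P11
  induction t using Nat.strong_induction_on with
  | _ t ih =>
    obtain ⟨x, i, hi, rfl⟩ : ∃ x i, i < 11 ∧ t = 11 * x + i := ⟨t / 11, t % 11, by omega, by omega⟩
    rcases Nat.lt_or_ge i 10 with h | h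
    · rw [mem_residueSet_of_lt P11_bounds h, mem_residueSet_of_lt Q11_bounds h]
      simp only [P11, Q11, Set.mem_insert_iff, Set.mem_singleton_iff]
      omega
    · obtain rfl : i = 10 := by omega
      rw [mem_residueSet_ten P11_bounds, mem_residueSet_ten Q11_bounds, ih x (by omega), not_not]

lemma ind_J11 (t : ℕ) : ind J11 t = ind K11 t + 1 := by
  classical
  simp only [ind, Set.indicator_apply, mem_J11_iff, Pi.one_apply]
  by_cases h : t ∈ K11 <;> simp [h]; rfl

lemma ind_J11_ten (x : ℕ) : ind J11 (11 * x + 10) = ind K11 x :=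
  ind_congr (mem_residueSet_ten P11_bounds)

lemma ind_J11_of_lt (x : ℕ) {i : ℕ} (hi : i < 10) :
    ind J11 (11 * x + i) = if Nat.testBit 285 i then 1 else 0 := by
  classical
  have : 11 * x + i ∈ J11 ↔ i + 1 ∈ P11 := mem_residueSet_of_lt P11_bounds hi
  simp only [ind, Set.indicator_apply, this, Pi.one_apply]
  congr 1
  simp only [P11, Set.mem_insert_iff, Set.mem_singleton_iff, eq_iff_iff]
  clear this
  revert i
  decide

end Indicator

section Determinants

/-- The `m × m` Hankel matrix of `S` over `ZMod 2` with row `l` replaced by ones. -/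
noncomputable def hankel (S : Set ℕ) (m l : ℕ) : Matrix (Fin m) (Fin m) (ZMod 2) :=
  of fun i j => if (i : ℕ) = l then 1 else ind S (i + j)

lemma permCount_cast (S : Set ℕ) (m l : ℕ) : (permCount S m l : ZMod 2) = (hankel S m l).det := by
  classical
  rw [← det_transpose, det_apply, permCount, Nat.card_eq_fintype_card, Fintype.card_subtype,
    card_filter, Nat.cast_sum]
  refine sum_congr rfl fun σ _ => ?_
  have hs : ∀ x : ZMod 2, Equiv.Perm.sign σ • x = x := by
    intro x
    rcases Int.units_eq_one_or (Equiv.Perm.sign σ) with h | h <;> rw [h]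
    · simp
    · rw [Units.neg_smul, one_smul, ZMod.neg_eq_self_mod_two]
  rw [hs]
  by_cases h : ∀ i : Fin m, (i : ℕ) ≠ l → ((i : ℕ) + ((σ i : Fin m) : ℕ)) ∈ S
  · rw [if_pos h, prod_eq_one, Nat.cast_one]
    intro i _
    by_cases hi : (i : ℕ) = l
    · simp [hankel, hi]
    · simp [hankel, hi, ind, h i hi]
  · rw [if_neg h, Nat.cast_zero]
    push Not at h
    obtain ⟨i, hi, hS⟩ := h
    exact (prod_eq_zero (mem_univ i) (by simp [hankel, hi, ind, hS])).symm

/-- Adding the all-ones matrix adds the determinants with one row replaced by ones. -/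
lemma det_add_ones {R : Type*} [CommRing R] {m : ℕ} (A : Matrix (Fin m) (Fin m) R) :
    (of fun i j => A i j + 1).det = A.det + ∑ l, (A.updateRow l 1).det := by
  classical
  have key : ∀ s : Finset (Fin m), (of fun i j => A i j + if i ∈ s then 1 else 0).det
      = A.det + ∑ l ∈ s, (A.updateRow l 1).det := by
    intro s
    induction s using Finset.induction_on with
    | empty => simp; rfl
    | insert k s hk ih =>
      rw [sum_insert hk, add_left_comm, ← ih]
      set M : Matrix (Fin m) (Fin m) R := of fun i j => A i j + if i ∈ s then 1 else 0 with hM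
      have h1 : (of fun i j => A i j + if i ∈ insert k s then 1 else 0)
          = M.updateRow k (1 + M k) := by
        ext i j
        by_cases h : i = k
        · subst h; simp [hM, hk, add_comm]
        · simp [hM, h]
      rw [h1, det_updateRow_add, updateRow_eq_self]
      congr 1
      refine det_eq_of_forall_row_eq_smul_add_const (fun i => if i ∈ s then 1 else 0) k
        (by simp [hk]) ?_
      intro i j
      by_cases h : i = k
      · subst h; simp [hk]
      · simp [hM, h]
  simpa using key univ

/-- The rectangular matrix `p` with `h` rows and `w` columns has trivial kernel. -/
def TrivKer (p : ℕ → ℕ → ZMod 2) (h w : ℕ) : Prop :=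
  ∀ z : ℕ → ZMod 2, (∀ i < h, ∑ j ∈ range w, p i j * z j = 0) → ∀ j < w, z j = 0

lemma det_ne_zero_iff_trivKer (p : ℕ → ℕ → ZMod 2) (m : ℕ) :
    (of fun i j : Fin m => p i j).det ≠ 0 ↔ TrivKer p m m := by
  rw [Ne, ← exists_mulVec_eq_zero_iff]
  push Not
  constructor
  · intro H z hz j hj
    by_contra hne
    refine H (fun i => z i) (fun h => hne (congrFun h ⟨j, hj⟩)) ?_
    ext i
    have := hz i i.2
    rw [← Fin.sum_univ_eq_sum_range (fun j => p i j * z j)] at this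
    simpa [mulVec, dotProduct] using this
  · intro H v hv h
    refine hv (funext fun j => ?_)
    have := H (fun i => if hi : i < m then v ⟨i, hi⟩ else 0) ?_ j j.2
    · simpa using this
    · intro i hi
      rw [← Fin.sum_univ_eq_sum_range
        (fun j => p i j * (if hj : j < m then v ⟨j, hj⟩ else 0))]
      simpa [mulVec, dotProduct] using congrFun h ⟨i, hi⟩

lemma TrivKer.transpose {p : ℕ → ℕ → ZMod 2} {m : ℕ} (H : TrivKer p m m) :
    TrivKer (fun i j => p j i) m m := by
  rw [← det_ne_zero_iff_trivKer] at H ⊢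
  rwa [← det_transpose] at H

lemma TrivKer.exists_eq {p : ℕ → ℕ → ZMod 2} {m : ℕ} (H : TrivKer p m m) (f : ℕ → ZMod 2) :
    ∃ z : ℕ → ZMod 2, ∀ i < m, ∑ j ∈ range m, p i j * z j = f i := by
  rw [← det_ne_zero_iff_trivKer] at H
  have hu := isUnit_iff_ne_zero.2 H
  set M : Matrix (Fin m) (Fin m) (ZMod 2) := of fun i j => p i j with hM
  set v := M⁻¹ *ᵥ (fun i : Fin m => f i) with hv
  have h : M *ᵥ v = fun i : Fin m => f i := by
    rw [hv, mulVec_mulVec, mul_nonsing_inv _ hu, one_mulVec]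
  refine ⟨fun i => if hi : i < m then v ⟨i, hi⟩ else 0, fun i hi => ?_⟩
  rw [← Fin.sum_univ_eq_sum_range (fun j => p i j * (if hj : j < m then v ⟨j, hj⟩ else 0))]
  simpa [mulVec, dotProduct, hM] using congrFun h ⟨i, hi⟩

end Determinants

section Counts

lemma hankel_self (S : Set ℕ) (m : ℕ) : hankel S m m = of fun i j : Fin m => ind S (i + j) := by
  ext i j
  simp [hankel, i.2.ne]

lemma hankel_eq_updateRow (S : Set ℕ) (m : ℕ) (l : Fin m) :
    hankel S m l = (hankel S m m).updateRow l 1 := by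
  ext i j
  by_cases h : i = l
  · subst h; simp [hankel]
  · simp [hankel, h, i.2.ne, Fin.val_ne_iff.2 h]

lemma permCount_self_ne_zero (S : Set ℕ) (m : ℕ) :
    (permCount S m m : ZMod 2) ≠ 0 ↔ TrivKer (fun i j => ind S (i + j)) m m := by
  rw [permCount_cast, hankel_self, ← det_ne_zero_iff_trivKer]

lemma sum_permCount_ne_zero (S : Set ℕ) (m : ℕ) :
    ((∑ i ∈ range m, permCount S m i : ℕ) : ZMod 2) + permCount S m m ≠ 0 ↔
      TrivKer (fun i j => ind S (i + j) + 1) m m := by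
  rw [← det_ne_zero_iff_trivKer, permCount_cast, Nat.cast_sum]
  have := det_add_ones (hankel S m m)
  rw [← Fin.sum_univ_eq_sum_range (fun i => (permCount S m i : ZMod 2)), add_comm]
  simp only [permCount_cast, hankel_eq_updateRow S m]
  rw [← this, hankel_self]
  rfl

lemma permCount_last_ne_zero (S : Set ℕ) (m : ℕ) :
    (permCount S (m + 1) m : ZMod 2) ≠ 0 ↔
      TrivKer (fun i j => if i = m then 1 else ind S (i + j)) (m + 1) (m + 1) := by
  rw [permCount_cast, ← det_ne_zero_iff_trivKer, hankel]

lemma trivKer_last_iff (p : ℕ → ℕ → ZMod 2) (m : ℕ) :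
    TrivKer (fun i j => if i = m then 1 else p i j) (m + 1) (m + 1) ↔
      ∀ z : ℕ → ZMod 2, (∀ i < m, ∑ j ∈ range (m + 1), p i j * z j = 0) →
        ∑ j ∈ range (m + 1), z j = 0 → ∀ j < m + 1, z j = 0 := by
  constructor
  · intro H z hz hs
    refine H z fun i hi => ?_
    by_cases him : i = m
    · simpa [him] using hs
    · simpa [him] using hz i (by omega)
  · intro H z hz
    refine H z (fun i hi => ?_) ?_
    · simpa [hi.ne] using hz i (by omega)
    · simpa using hz m (by omega)

end Counts

section Blocks

/-- The `h × w` Hankel block of `b` has no kernel vector with zero coordinate sum. -/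
def BlockInj (b : ℕ → ZMod 2) (h w : ℕ) : Prop :=
  ∀ z : ℕ → ZMod 2, (∀ x < h, ∑ y ∈ range w, b (x + y) * z y = 0) →
    ∑ y ∈ range w, z y = 0 → ∀ y < w, z y = 0

/-- Some vector with coordinate sum `s` is sent to `t` times the all-ones vector. -/
def BlockRel (b : ℕ → ZMod 2) (h w : ℕ) (s t : ZMod 2) : Prop :=
  ∃ z : ℕ → ZMod 2, (∀ x < h, ∑ y ∈ range w, b (x + y) * z y = t) ∧ ∑ y ∈ range w, z y = s

lemma zmod2_eq_one {a : ZMod 2} (h : a ≠ 0) : a = 1 := by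
  revert h; revert a; decide

lemma sum_add_one_mul {w : ℕ} (f z : ℕ → ZMod 2) :
    ∑ y ∈ range w, (f y + 1) * z y = ∑ y ∈ range w, f y * z y + ∑ y ∈ range w, z y := by
  rw [← sum_add_distrib]
  exact sum_congr rfl fun y _ => by ring

lemma sum_mul_add {w : ℕ} (f z z' : ℕ → ZMod 2) :
    ∑ y ∈ range w, f y * (z y + z' y)
      = ∑ y ∈ range w, f y * z y + ∑ y ∈ range w, f y * z' y := by
  rw [← sum_add_distrib]
  exact sum_congr rfl fun y _ => by ring

variable {b : ℕ → ZMod 2} {q : ℕ} {u v : ZMod 2}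

/-- A vector outside the kernel on `range w`, if the kernel is non-trivial. -/
lemma exists_of_not_trivKer {p : ℕ → ℕ → ZMod 2} {h w : ℕ} (H : ¬ TrivKer p h w) :
    ∃ z : ℕ → ZMod 2, (∀ i < h, ∑ j ∈ range w, p i j * z j = 0) ∧ ∃ j < w, z j ≠ 0 := by
  unfold TrivKer at H
  push Not at H
  exact H

lemma blockInj_square (hv : v ≠ 0 ↔ TrivKer (fun i j => b (i + j)) q q)
    (hu : u + v ≠ 0 ↔ TrivKer (fun i j => b (i + j) + 1) q q) :
    BlockInj b q q ↔ ¬ (u = 0 ∧ v = 0) := by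
  constructor
  · rintro H ⟨rfl, rfl⟩
    obtain ⟨z, hz, j, hj, hzj⟩ := exists_of_not_trivKer (hv.not.1 (by simp))
    obtain ⟨z', hz', j', hj', hzj'⟩ := exists_of_not_trivKer (hu.not.1 (by simp))
    simp only [sum_add_one_mul] at hz'
    have h1 : ∑ y ∈ range q, z y = 1 := zmod2_eq_one fun h => hzj (H z hz h j hj)
    have h1' : ∑ y ∈ range q, z' y = 1 := by
      refine zmod2_eq_one fun h => hzj' (H z' (fun x hx => ?_) h j' hj')
      simpa [h] using hz' x hx
    have h2 : ∀ x < q, ∑ y ∈ range q, b (x + y) * z' y = 1 := by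
      intro x hx
      have := hz' x hx
      rw [h1'] at this
      rw [eq_neg_of_add_eq_zero_left this]; decide
    have h3 : ∑ x ∈ range q, z x * ∑ y ∈ range q, b (x + y) * z' y = 1 := by
      rw [← h1]
      exact sum_congr rfl fun x hx => by rw [h2 x (mem_range.1 hx), mul_one]
    have h4 : ∑ x ∈ range q, z x * ∑ y ∈ range q, b (x + y) * z' y = 0 := by
      simp_rw [mul_sum]
      rw [sum_comm]
      refine sum_eq_zero fun y hy => ?_
      have : ∑ x ∈ range q, z' y * (b (y + x) * z x) = 0 := by
        rw [← mul_sum, hz y (mem_range.1 hy), mul_zero]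
      rw [← this]
      exact sum_congr rfl fun x _ => by rw [add_comm x y]; ring
    rw [h3] at h4
    exact one_ne_zero h4
  · intro H z hz hs
    by_cases h : v = 0
    · have hu0 : u + v ≠ 0 := by rw [h, add_zero]; exact fun h' => H ⟨h', h⟩
      refine hu.1 hu0 z fun x hx => ?_
      rw [sum_add_one_mul, hz x hx, hs, add_zero]
    · exact hv.1 h z hz

lemma blockRel_square (hv : v ≠ 0 ↔ TrivKer (fun i j => b (i + j)) q q)
    (hu : u + v ≠ 0 ↔ TrivKer (fun i j => b (i + j) + 1) q q) (h0 : ¬ (u = 0 ∧ v = 0))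
    (s t : ZMod 2) : BlockRel b q q s t ↔ v * s + u * t = 0 := by
  have hinj := (blockInj_square hv hu).2 h0
  have zero_of : ∀ z : ℕ → ZMod 2, (∀ y < q, z y = 0) → ∑ y ∈ range q, z y = 0 :=
    fun z hz => sum_eq_zero fun y hy => hz y (mem_range.1 hy)
  have two : ∀ a : ZMod 2, a + a = 0 := by decide
  by_cases hv0 : v = 0
  · subst hv0
    have hu1 : u = 1 := zmod2_eq_one fun h => h0 ⟨h, rfl⟩
    subst hu1
    have hB := hu.1 (by decide)
    obtain ⟨k, hk, j, hj, hkj⟩ := exists_of_not_trivKer (hv.not.1 (by simp))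
    have hk1 : ∑ y ∈ range q, k y = 1 := zmod2_eq_one fun h => hkj (hinj k hk h j hj)
    simp only [zero_mul, one_mul, zero_add]
    constructor
    · rintro ⟨z, hz, rfl⟩
      by_contra ht
      have ht := zmod2_eq_one ht
      subst ht
      by_cases hs : ∑ y ∈ range q, z y = 0
      · have := zero_of _ (hB (fun y => z y + k y) fun x hx => by
          rw [sum_add_one_mul, sum_mul_add, hz x hx, hk x hx, sum_add_distrib, hs, hk1]; decide)
        rw [sum_add_distrib, hs, hk1] at this
        revert this; decide
      · have hs := zmod2_eq_one hs
        have := zero_of _ (hB z fun x hx => by rw [sum_add_one_mul, hz x hx, hs]; decide)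
        rw [hs] at this
        revert this; decide
    · rintro rfl
      exact ⟨fun y => s * k y, fun x hx => by
        simp_rw [mul_left_comm _ s]; rw [← mul_sum, hk x hx, mul_zero], by
        rw [← mul_sum, hk1, mul_one]⟩
  · have hv1 := zmod2_eq_one hv0
    subst hv1
    have hB := hv.1 one_ne_zero
    obtain ⟨k, hk⟩ := hB.exists_eq fun _ => 1
    have hku : ∑ y ∈ range q, k y = u := by
      by_cases hu0 : u = 0
      · subst hu0
        have hB' := hu.1 (by simp)
        by_contra hs
        have hs := zmod2_eq_one hs
        have := zero_of _ (hB' k fun x hx => by rw [sum_add_one_mul, hk x hx, hs]; decide)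
        exact one_ne_zero (hs.symm.trans this)
      · have := zmod2_eq_one hu0
        subst this
        obtain ⟨z, hz, j, hj, hzj⟩ := exists_of_not_trivKer (hu.not.1 (by decide))
        simp only [sum_add_one_mul] at hz
        have hz1 : ∑ y ∈ range q, z y = 1 := by
          refine zmod2_eq_one fun h => hzj (hinj z (fun x hx => ?_) h j hj)
          simpa [h] using hz x hx
        have := zero_of _ (hB (fun y => z y + k y) fun x hx => by
          have := hz x hx
          rw [hz1] at this
          rw [sum_mul_add, hk x hx, this])
        rw [sum_add_distrib, hz1] at this
        rw [eq_neg_of_add_eq_zero_right this]; decide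
    constructor
    · rintro ⟨z, hz, rfl⟩
      have := zero_of _ (hB (fun y => z y + t * k y) fun x hx => by
        rw [sum_mul_add, hz x hx]
        simp_rw [mul_left_comm _ t]
        rw [← mul_sum, hk x hx, mul_one, two])
      rw [sum_add_distrib, ← mul_sum, hku] at this
      rw [← this]; ring
    · intro h
      refine ⟨fun y => t * k y, fun x hx => ?_, ?_⟩
      · simp_rw [mul_left_comm _ t]
        rw [← mul_sum, hk x hx, mul_one]
      · rw [← mul_sum, hku]
        have : s = -(u * t) := eq_neg_of_add_eq_zero_left (by simpa using h)
        rw [this, ZMod.neg_eq_self_mod_two, mul_comm]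

variable {p : ℕ} {w : ZMod 2}

lemma blockInj_wide
    (hw : w ≠ 0 ↔ TrivKer (fun i j => if i = p then 1 else b (i + j)) (p + 1) (p + 1)) :
    BlockInj b p (p + 1) ↔ w ≠ 0 := by
  rw [hw, trivKer_last_iff (fun i j => b (i + j))]; rfl

lemma blockRel_wide
    (hw : w ≠ 0 ↔ TrivKer (fun i j => if i = p then 1 else b (i + j)) (p + 1) (p + 1))
    (h0 : w ≠ 0) (s t : ZMod 2) : BlockRel b p (p + 1) s t := by
  obtain ⟨z, hz⟩ := (hw.1 h0).exists_eq fun i => if i = p then s else t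
  refine ⟨z, fun x hx => ?_, ?_⟩
  · simpa [hx.ne] using hz x (by omega)
  · simpa using hz p (by omega)

lemma tall_trivial
    (hw : w ≠ 0 ↔ TrivKer (fun i j => if i = p then 1 else b (i + j)) (p + 1) (p + 1))
    (h0 : w ≠ 0) {z : ℕ → ZMod 2} {t : ZMod 2}
    (hz : ∀ x < p + 1, ∑ y ∈ range p, b (x + y) * z y = t) : (∀ y < p, z y = 0) ∧ t = 0 := by
  have H := (hw.1 h0).transpose (fun y => if y = p then t else z y) fun x hx => by
    rw [sum_range_succ]
    have : ∑ y ∈ range p, (if y = p then 1 else b (y + x)) * (if y = p then t else z y)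
        = ∑ y ∈ range p, b (x + y) * z y :=
      sum_congr rfl fun y hy => by simp [(mem_range.1 hy).ne, add_comm x y]
    rw [this, hz x hx]
    simp only [if_true, one_mul]
    exact CharTwo.add_self_eq_zero t
  exact ⟨fun y hy => by simpa [hy.ne] using H y (by omega), by simpa using H p (by omega)⟩

lemma blockInj_tall
    (hw : w ≠ 0 ↔ TrivKer (fun i j => if i = p then 1 else b (i + j)) (p + 1) (p + 1))
    (h0 : w ≠ 0) : BlockInj b (p + 1) p :=
  fun _ hz _ => (tall_trivial hw h0 hz).1

lemma blockRel_tall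
    (hw : w ≠ 0 ↔ TrivKer (fun i j => if i = p then 1 else b (i + j)) (p + 1) (p + 1))
    (h0 : w ≠ 0) (s t : ZMod 2) : BlockRel b (p + 1) p s t ↔ s = 0 ∧ t = 0 := by
  constructor
  · rintro ⟨z, hz, rfl⟩
    obtain ⟨h1, h2⟩ := tall_trivial hw h0 hz
    exact ⟨sum_eq_zero fun y hy => h1 y (mem_range.1 hy), h2⟩
  · rintro ⟨rfl, rfl⟩
    exact ⟨0, by simp, by simp⟩

end Blocks

section Decomposition

lemma sum_range_residues (f : ℕ → ZMod 2) (m : ℕ) :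
    ∑ j ∈ range m, f j = ∑ s ∈ range 11, ∑ y ∈ range ((m + 10 - s) / 11), f (11 * y + s) := by
  rw [sum_sigma']
  refine sum_nbij' (fun j => ⟨j % 11, j / 11⟩) (fun x => 11 * x.2 + x.1) ?_ ?_ ?_ ?_ ?_
  · intro j hj
    simp only [mem_sigma, mem_range] at hj ⊢
    omega
  · rintro ⟨s, y⟩ h
    simp only [mem_sigma, mem_range] at h ⊢
    omega
  · intro j _
    exact Nat.div_add_mod j 11
  · rintro ⟨s, y⟩ h
    simp only [mem_sigma, mem_range] at h
    have h1 : (11 * y + s) % 11 = s := by omega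
    have h2 : (11 * y + s) / 11 = y := by omega
    simp [h1, h2]
  · intro j _
    simp only
    rw [Nat.div_add_mod]

variable {b : ℕ → ZMod 2} {p : ℕ → ℕ → ZMod 2} {C : ℕ → ℕ → ZMod 2}

lemma row_sum (hp : ∀ r < 11, ∀ s < 11, ∀ x y,
      p (11 * x + r) (11 * y + s) = (if r + s = 10 then b (x + y) else 0) + C r s)
    (m x : ℕ) {r : ℕ} (hr : r < 11) (z : ℕ → ZMod 2) :
    ∑ j ∈ range m, p (11 * x + r) j * z j
      = ∑ y ∈ range ((m + 10 - (10 - r)) / 11), b (x + y) * z (11 * y + (10 - r))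
        + ∑ s ∈ range 11, C r s * ∑ y ∈ range ((m + 10 - s) / 11), z (11 * y + s) := by
  rw [sum_range_residues]
  have : ∀ s ∈ range 11,
      ∑ y ∈ range ((m + 10 - s) / 11), p (11 * x + r) (11 * y + s) * z (11 * y + s) =
        (if s = 10 - r then ∑ y ∈ range ((m + 10 - s) / 11), b (x + y) * z (11 * y + s) else 0)
        + C r s * ∑ y ∈ range ((m + 10 - s) / 11), z (11 * y + s) := by
    intro s hs
    rw [mem_range] at hs
    have e : r + s = 10 ↔ s = 10 - r := by omega
    simp only [hp r hr s hs, e, add_mul, sum_add_distrib, mul_sum]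
    congr 1
    split_ifs <;> simp
  rw [sum_congr rfl this, sum_add_distrib, sum_ite_eq' (range 11) (10 - r), if_pos]
  simp; omega

/-- The kernel of a matrix built from antidiagonal Hankel blocks and constant blocks, with an
additional row of ones if `E` holds, is governed by the blocks and a system in `11` unknowns. -/
lemma kernel_decomposition (hp : ∀ r < 11, ∀ s < 11, ∀ x y,
      p (11 * x + r) (11 * y + s) = (if r + s = 10 then b (x + y) else 0) + C r s)
    (N m : ℕ) (E : Prop) :
    (∀ z : ℕ → ZMod 2, (∀ i < N, ∑ j ∈ range m, p i j * z j = 0) →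
        (E → ∑ j ∈ range m, z j = 0) → ∀ j < m, z j = 0) ↔
      (∀ r < 11, BlockInj b ((N + 10 - r) / 11) ((m + 10 - (10 - r)) / 11)) ∧
      ∀ σ : ℕ → ZMod 2,
        (∀ r < 11, BlockRel b ((N + 10 - r) / 11) ((m + 10 - (10 - r)) / 11)
          (σ (10 - r)) (∑ s ∈ range 11, C r s * σ s)) →
        (E → ∑ s ∈ range 11, σ s = 0) → ∀ s < 11, σ s = 0 := by
  constructor
  · intro H
    constructor
    · intro r hr z hz hs y hy
      let z' : ℕ → ZMod 2 := fun j => if j % 11 = 10 - r then z (j / 11) else 0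
      have h1 : ∀ s < 11, ∀ y, z' (11 * y + s) = if s = 10 - r then z y else 0 := by
        intro s hs y
        have e1 : (11 * y + s) % 11 = s := by omega
        have e2 : (11 * y + s) / 11 = y := by omega
        simp only [z', e1, e2]
      have h2 : ∀ s < 11, ∑ y ∈ range ((m + 10 - s) / 11), z' (11 * y + s) = 0 := by
        intro s hs'
        simp only [h1 s hs']
        split_ifs with h
        · rw [h]; exact hs
        · simp
      have := H z' (fun i hi => ?_) (fun _ => ?_) (11 * y + (10 - r)) (by omega)
      · simpa [h1 (10 - r) (by omega)] using this
      · have hi' : i = 11 * (i / 11) + i % 11 := by omega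
        have hlt : i % 11 < 11 := by omega
        rw [hi', row_sum hp m (i / 11) hlt, sum_eq_zero (s := range 11), add_zero]
        · simp only [h1 (10 - i % 11) (by omega)]
          split_ifs with h
          · have : i % 11 = r := by omega
            rw [this]
            exact hz _ (by omega)
          · simp
        · intro s hs'
          rw [h2 s (mem_range.1 hs'), mul_zero]
      · rw [sum_range_residues]
        exact sum_eq_zero fun s hs' => h2 s (mem_range.1 hs')
    · intro σ hσ hE
      choose! f hf1 hf2 using hσ
      let z : ℕ → ZMod 2 := fun j => f (10 - j % 11) (j / 11)
      have h1 : ∀ s < 11, ∀ y, z (11 * y + s) = f (10 - s) y := by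
        intro s hs y
        have e1 : (11 * y + s) % 11 = s := by omega
        have e2 : (11 * y + s) / 11 = y := by omega
        simp only [z, e1, e2]
      have h2 : ∀ s < 11, ∑ y ∈ range ((m + 10 - s) / 11), z (11 * y + s) = σ s := by
        intro s hs
        simp only [h1 s hs]
        have := hf2 (10 - s) (by omega)
        rwa [show 10 - (10 - s) = s by omega] at this
      have h3 := H z (fun i hi => ?_) fun h => ?_
      · intro s hs
        rw [← h2 s hs]
        refine sum_eq_zero fun y hy => h3 _ ?_
        rw [mem_range] at hy
        omega
      · have hi' : i = 11 * (i / 11) + i % 11 := by omega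
        have hlt : i % 11 < 11 := by omega
        rw [hi', row_sum hp m (i / 11) hlt]
        have e1 : ∑ s ∈ range 11, C (i % 11) s * ∑ y ∈ range ((m + 10 - s) / 11), z (11 * y + s)
            = ∑ s ∈ range 11, C (i % 11) s * σ s :=
          sum_congr rfl fun s hs => by rw [h2 s (mem_range.1 hs)]
        have e2 := hf1 (i % 11) hlt (i / 11) (by omega)
        simp only [h1 (10 - i % 11) (by omega), show 10 - (10 - i % 11) = i % 11 by omega]
        rw [e1, e2]
        exact CharTwo.add_self_eq_zero _
      · rw [sum_range_residues, ← hE h]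
        exact sum_congr rfl fun s hs => h2 s (mem_range.1 hs)
  · rintro ⟨Ha, Hb⟩ z hz hE j hj
    have hσ := Hb (fun s => ∑ y ∈ range ((m + 10 - s) / 11), z (11 * y + s)) (fun r hr => ?_) ?_
    · have hr : 10 - j % 11 < 11 := by omega
      have e10 : 10 - (10 - j % 11) = j % 11 := by omega
      have := Ha (10 - j % 11) hr (fun y => z (11 * y + j % 11)) (fun x hx => ?_)
        (by rw [e10]; exact hσ _ (by omega)) (j / 11) (by omega)
      · simpa [Nat.div_add_mod] using this
      · have := hz (11 * x + (10 - j % 11)) (by omega)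
        rw [row_sum hp m x hr, sum_eq_zero (s := range 11), add_zero] at this
        · rwa [e10] at this ⊢
        · intro s hs
          rw [hσ s (mem_range.1 hs), mul_zero]
    · refine ⟨fun y => z (11 * y + (10 - r)), fun x hx => ?_, rfl⟩
      have := hz (11 * x + r) (by omega)
      rw [row_sum hp m x hr] at this
      rw [eq_neg_of_add_eq_zero_left this, ZMod.neg_eq_self_mod_two]
    · intro h
      rw [← hE h, sum_range_residues z m]

end Decomposition

section Elimination

/-- The linear form over `ZMod 2` in the first `k` variables with coefficients the bits of `a`. -/
def bitForm (k a : ℕ) (σ : ℕ → ZMod 2) : ZMod 2 :=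
  ∑ i ∈ range k, (if a.testBit i then 1 else 0) * σ i

lemma bitForm_xor (k a c : ℕ) (σ : ℕ → ZMod 2) :
    bitForm k (a ^^^ c) σ = bitForm k a σ + bitForm k c σ := by
  unfold bitForm
  rw [← sum_add_distrib]
  refine sum_congr rfl fun i _ => ?_
  rw [Nat.testBit_xor, ← add_mul]
  congr 1
  cases a.testBit i <;> cases c.testBit i <;> decide

lemma bitForm_zero (k : ℕ) (σ : ℕ → ZMod 2) : bitForm k 0 σ = 0 := by
  simp [bitForm]

lemma bitForm_succ (k a : ℕ) (σ : ℕ → ZMod 2) :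
    bitForm (k + 1) a σ
      = bitForm k (a >>> 1) (fun i => σ (i + 1)) + (if a.testBit 0 then 1 else 0) * σ 0 := by
  simp only [bitForm, sum_range_succ', Nat.testBit_shiftRight, add_comm 1]

/-- The forms encoded by `l` vanish simultaneously only at zero. -/
def TrivSystem (k : ℕ) (l : List ℕ) : Prop :=
  ∀ σ : ℕ → ZMod 2, (∀ a ∈ l, bitForm k a σ = 0) → ∀ i < k, σ i = 0

/-- Gaussian elimination deciding `TrivSystem`. -/
def fullRank : ℕ → List ℕ → Bool
  | 0, _ => true
  | k + 1, l =>
    match l.find? fun a => a.testBit 0 with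
    | none => false
    | some c => fullRank k (l.map fun a => (if a.testBit 0 then a ^^^ c else a) >>> 1)

lemma fullRank_iff (k : ℕ) (l : List ℕ) : fullRank k l = true ↔ TrivSystem k l := by
  induction k generalizing l with
  | zero => simp [fullRank, TrivSystem]
  | succ k ih =>
    rw [fullRank]
    rcases hc : l.find? fun a => a.testBit 0 with _ | c
    · rw [hc]
      rw [List.find?_eq_none] at hc
      simp only [Bool.false_eq_true, false_iff]
      intro H
      have := H (fun i => if i = 0 then 1 else 0) (fun a ha => ?_) 0 (by omega)
      · simp at this
      · rw [bitForm_succ, if_neg (hc a ha)]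
        simp [bitForm]
    · have hbit : c.testBit 0 = true := by simpa using List.find?_some hc
      have hmem := List.mem_of_find?_eq_some hc
      have step : ∀ (a : ℕ) (σ : ℕ → ZMod 2), bitForm (k + 1) c σ = 0 →
          bitForm k ((if a.testBit 0 then a ^^^ c else a) >>> 1) (fun i => σ (i + 1))
            = bitForm (k + 1) a σ := by
        intro a σ hσ
        split_ifs with h
        · have := bitForm_succ k (a ^^^ c) σ
          rw [bitForm_xor, hσ, Nat.testBit_xor, h, hbit] at this
          simpa using this.symm
        · rw [bitForm_succ, if_neg h, zero_mul, add_zero]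
      rw [hc]
      dsimp only
      rw [ih]
      constructor
      · intro H σ hσ
        have h1 := H (fun i => σ (i + 1)) fun a' ha' => by
          obtain ⟨a, ha, rfl⟩ := List.mem_map.1 ha'
          rw [step a σ (hσ c hmem), hσ a ha]
        intro i hi
        rcases i with _ | i
        · have h2 := hσ c hmem
          rw [bitForm_succ, hbit, bitForm, sum_eq_zero] at h2
          · simpa using h2
          · intro i hi
            rw [h1 i (mem_range.1 hi), mul_zero]
        · exact h1 i (by omega)
      · intro H τ hτ i hi
        let σ : ℕ → ZMod 2 := fun j => Nat.casesOn j (bitForm k (c >>> 1) τ) τ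
        have hcσ : bitForm (k + 1) c σ = 0 := by
          rw [bitForm_succ, hbit]
          simp only [if_true, one_mul]
          exact CharTwo.add_self_eq_zero _
        refine H σ (fun a ha => ?_) (i + 1) (by omega)
        rw [← step a σ hcσ]
        exact hτ _ (List.mem_map.2 ⟨a, ha, rfl⟩)

end Elimination

section Evaluation

/-- The bits of the `r`-th row of constants, complemented if `e`. -/
def rowMask (e : Bool) (r : ℕ) : ℕ :=
  ((285 * 2049) >>> r) % 2048 ^^^ (if e then 2047 else 0)

lemma entry_eq (e : Bool) : ∀ r < 11, ∀ s < 11, ∀ x y : ℕ,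
    ind J11 (11 * x + r + (11 * y + s)) + (if e then 1 else 0)
      = (if r + s = 10 then ind K11 (x + y) else 0)
        + (if (rowMask e r).testBit s then 1 else 0) := by
  intro r hr s hs x y
  have hm : (rowMask e r).testBit s = (Nat.testBit 285 ((r + s) % 11) ^^ e) := by
    revert e r s; decide
  have h10 : Nat.testBit 285 10 = false := by decide
  rw [hm]
  clear hm
  rcases lt_trichotomy (r + s) 10 with h | h | h
  · rw [show 11 * x + r + (11 * y + s) = 11 * (x + y) + (r + s) by ring, ind_J11_of_lt _ h,
      if_neg h.ne, Nat.mod_eq_of_lt (by omega : r + s < 11), zero_add]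
    generalize Nat.testBit 285 (r + s) = c
    revert c e; decide
  · rw [show 11 * x + r + (11 * y + s) = 11 * (x + y) + (r + s) by ring, h, ind_J11_ten,
      if_pos rfl, Nat.mod_eq_of_lt (by omega), h10, Bool.false_xor]
  · rw [show 11 * x + r + (11 * y + s) = 11 * (x + y + 1) + (r + s) % 11 by omega,
      ind_J11_of_lt _ (by omega), if_neg h.ne']
    generalize Nat.testBit 285 ((r + s) % 11) = c
    rw [zero_add]
    revert c e; decide

/-- The block in row class `r` is square, if `a` and `t` classes of rows and columns are long. -/
def SquareBlock (a t r : ℕ) : Prop := r < a ↔ 10 - r < t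

instance (a t r : ℕ) : Decidable (SquareBlock a t r) :=
  inferInstanceAs (Decidable (r < a ↔ 10 - r < t))

/-- The forms of the system in the block sums, for row counts given by `a`, column counts given
by `t`, and block invariants `u`, `v`; a row of ones is added if `x`. -/
def systemRows (a t : ℕ) (e x : Bool) (u v : ZMod 2) : List ℕ :=
  (if x then [2047] else []) ++ (List.range 11).flatMap fun r =>
    if SquareBlock a t r then
      [(if v = 0 then 0 else 2 ^ (10 - r)) ^^^ (if u = 0 then 0 else rowMask e r)]
    else if r < a then [2 ^ (10 - r), rowMask e r] else []

/-- The predicted determinant. -/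
def detValue (a t : ℕ) (e x : Bool) (u v w : ZMod 2) : ZMod 2 :=
  (if (∀ r : ℕ, r < 11 → SquareBlock a t r) ∨ w ≠ 0 then 1 else 0) *
    (if (∀ r : ℕ, r < 11 → ¬ SquareBlock a t r) ∨ ¬ (u = 0 ∧ v = 0) then 1 else 0) *
    (if fullRank 11 (systemRows a t e x u v) then 1 else 0)

lemma bitForm_two_pow {i : ℕ} (hi : i < 11) (σ : ℕ → ZMod 2) : bitForm 11 (2 ^ i) σ = σ i := by
  simp [bitForm, Nat.testBit_two_pow, hi]

lemma bitForm_ones (σ : ℕ → ZMod 2) : bitForm 11 2047 σ = ∑ s ∈ range 11, σ s := by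
  refine sum_congr rfl fun i hi => ?_
  have : ∀ i < 11, Nat.testBit 2047 i = true := by decide
  rw [this i (mem_range.1 hi), if_pos rfl, one_mul]

lemma forall_systemRows {a t : ℕ} {e x : Bool} {u v : ZMod 2} {σ : ℕ → ZMod 2} :
    (∀ c ∈ systemRows a t e x u v, bitForm 11 c σ = 0) ↔
      (∀ r < 11,
        (SquareBlock a t r → v * σ (10 - r) + u * bitForm 11 (rowMask e r) σ = 0) ∧
        (¬ SquareBlock a t r → r < a → σ (10 - r) = 0 ∧ bitForm 11 (rowMask e r) σ = 0)) ∧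
      (x = true → ∑ s ∈ range 11, σ s = 0) := by
  have hx : (∀ c ∈ (if x then [2047] else []), bitForm 11 c σ = 0) ↔
      (x = true → ∑ s ∈ range 11, σ s = 0) := by
    rw [← bitForm_ones]
    cases x <;> simp
  simp only [systemRows, List.forall_mem_append, hx, List.forall_mem_flatMap, List.mem_range]
  rw [and_comm]
  refine and_congr_left' (forall₂_congr fun r hr => ?_)
  have h10 : 10 - r < 11 := by omega
  by_cases hs : SquareBlock a t r
  · have hv : bitForm 11 (if v = 0 then 0 else 2 ^ (10 - r)) σ = v * σ (10 - r) := by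
      split_ifs with h
      · rw [h, bitForm_zero, zero_mul]
      · rw [zmod2_eq_one h, bitForm_two_pow h10, one_mul]
    have hu : bitForm 11 (if u = 0 then 0 else rowMask e r) σ
        = u * bitForm 11 (rowMask e r) σ := by
      split_ifs with h
      · rw [h, bitForm_zero, zero_mul]
      · rw [zmod2_eq_one h, one_mul]
    rw [if_pos hs]
    simp [hs, bitForm_xor, hv, hu]
  · rw [if_neg hs]
    by_cases ha : r < a
    · simp [ha, hs, bitForm_two_pow h10]
    · simp [ha, hs]

lemma trivKer_iff_detValue {p d a t : ℕ} {e x : Bool} {u v w : ZMod 2} (ha : a ≤ 10) (ht : t ≤ 11)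
    (hd : ∀ r < 11, SquareBlock a t r → d = if r < a then 1 else 0)
    (hwide : (∃ r < 11, ¬ SquareBlock a t r) → ∃ r < 11, ¬ r < a ∧ 10 - r < t)
    (hv : v ≠ 0 ↔ TrivKer (fun i j => ind K11 (i + j)) (p + d) (p + d))
    (hu : u + v ≠ 0 ↔ TrivKer (fun i j => ind K11 (i + j) + 1) (p + d) (p + d))
    (hw : w ≠ 0 ↔ TrivKer (fun i j => if i = p then 1 else ind K11 (i + j)) (p + 1) (p + 1)) :
    (∀ z : ℕ → ZMod 2,
        (∀ i < 11 * p + a, ∑ j ∈ range (11 * p + t),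
          (ind J11 (i + j) + if e then 1 else 0) * z j = 0) →
        (x = true → ∑ j ∈ range (11 * p + t), z j = 0) → ∀ j < 11 * p + t, z j = 0) ↔
      detValue a t e x u v w ≠ 0 := by
  rw [kernel_decomposition (p := fun i j => ind J11 (i + j) + if e then 1 else 0) (entry_eq e)]
  have hrow : ∀ r < 11, (11 * p + a + 10 - r) / 11 = p + if r < a then 1 else 0 := by
    intro r hr; split_ifs <;> omega
  have hcol : ∀ r < 11,
      (11 * p + t + 10 - (10 - r)) / 11 = p + if 10 - r < t then 1 else 0 := by
    intro r hr; split_ifs <;> omega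
  have hsq : ∀ r < 11, SquareBlock a t r →
      (11 * p + a + 10 - r) / 11 = p + d ∧ (11 * p + t + 10 - (10 - r)) / 11 = p + d := by
    intro r hr h
    rw [hrow r hr, hcol r hr, hd r hr h]
    exact ⟨rfl, congrArg _ (if_congr (Iff.symm h) rfl rfl)⟩
  have hinj : (∀ r < 11, BlockInj (ind K11) ((11 * p + a + 10 - r) / 11)
        ((11 * p + t + 10 - (10 - r)) / 11)) ↔
      ((∀ r < 11, SquareBlock a t r) ∨ w ≠ 0) ∧
      ((∀ r < 11, ¬ SquareBlock a t r) ∨ ¬ (u = 0 ∧ v = 0)) := by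
    constructor
    · intro H
      constructor
      · by_contra hcon
        push Not at hcon
        obtain ⟨⟨r, hr, hne⟩, hw0⟩ := hcon
        obtain ⟨r, hr, h1, h2⟩ := hwide ⟨r, hr, hne⟩
        have := H r hr
        rw [hrow r hr, hcol r hr, if_neg h1, if_pos h2, add_zero, blockInj_wide hw] at this
        exact this hw0
      · by_contra hcon
        push Not at hcon
        obtain ⟨⟨r, hr, h⟩, h0⟩ := hcon
        have := H r hr
        rw [(hsq r hr h).1, (hsq r hr h).2, blockInj_square hv hu] at this
        exact this h0
    · rintro ⟨H1, H2⟩ r hr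
      by_cases h : SquareBlock a t r
      · rw [(hsq r hr h).1, (hsq r hr h).2, blockInj_square hv hu]
        exact H2.resolve_left fun H => H r hr h
      · have hw0 := H1.resolve_left fun H => h (H r hr)
        rw [hrow r hr, hcol r hr]
        by_cases h1 : r < a
        · have h2 : ¬ 10 - r < t := fun h2 => h (iff_of_true h1 h2)
          rw [if_pos h1, if_neg h2]
          exact blockInj_tall hw hw0
        · have h2 : 10 - r < t := not_not.1 fun h2 => h (iff_of_false h1 h2)
          rw [if_neg h1, if_pos h2]
          exact (blockInj_wide hw).2 hw0
  have hval : detValue a t e x u v w ≠ 0 ↔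
      (((∀ r < 11, SquareBlock a t r) ∨ w ≠ 0) ∧
      ((∀ r < 11, ¬ SquareBlock a t r) ∨ ¬ (u = 0 ∧ v = 0))) ∧
      fullRank 11 (systemRows a t e x u v) = true := by
    simp only [detValue, mul_ne_zero_iff, ite_ne_right_iff, ne_eq, one_ne_zero,
      not_false_eq_true, and_true]
  rw [hval, hinj]
  refine and_congr_right fun ⟨H1, H2⟩ => ?_
  rw [fullRank_iff]
  refine forall_congr' fun σ => ?_
  rw [forall_systemRows, and_imp]
  refine imp_congr_left (forall₂_congr fun r hr => ?_)
  change BlockRel _ _ _ _ (bitForm 11 (rowMask e r) σ) ↔ _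
  by_cases h : SquareBlock a t r
  · rw [(hsq r hr h).1, (hsq r hr h).2,
      blockRel_square hv hu (H2.resolve_left fun H => H r hr h)]
    simp only [h, not_true_eq_false, false_imp_iff, true_imp_iff, and_true]
  · have hw0 := H1.resolve_left fun H => h (H r hr)
    rw [hrow r hr, hcol r hr]
    by_cases h1 : r < a
    · have h2 : ¬ 10 - r < t := fun h2 => h (iff_of_true h1 h2)
      rw [if_pos h1, if_neg h2, add_zero, blockRel_tall hw hw0]
      simp only [h, h1, false_imp_iff, true_imp_iff, true_and, not_false_eq_true]
    · have h2 : 10 - r < t := not_not.1 fun h2 => h (iff_of_false h1 h2)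
      rw [if_neg h1, if_pos h2, add_zero]
      have := blockRel_wide hw hw0 (σ (10 - r)) (bitForm 11 (rowMask e r) σ)
      simp only [h, h1, this, false_imp_iff, imp_true_iff, and_true]

end Evaluation

section Recurrences

lemma zmod2_eq_of_ne_zero_iff {a b : ZMod 2} (h : a ≠ 0 ↔ b ≠ 0) : a = b := by
  revert h; revert a b; decide

/-- The excess of the size of the square blocks in size `11 * n + t` over `n`. -/
def squareShift (t : ℕ) : ℕ := if 6 ≤ t then 1 else 0

lemma U_add_V_ne_zero (n : ℕ) :
    (U n : ZMod 2) + V n ≠ 0 ↔ TrivKer (fun i j => ind K11 (i + j) + 1) n n :=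
  sum_permCount_ne_zero K11 n

lemma V_ne_zero (n : ℕ) : (V n : ZMod 2) ≠ 0 ↔ TrivKer (fun i j => ind K11 (i + j)) n n :=
  permCount_self_ne_zero K11 n

lemma W_succ_ne_zero (n : ℕ) : (W (n + 1) : ZMod 2) ≠ 0 ↔
    TrivKer (fun i j => if i = n then 1 else ind K11 (i + j)) (n + 1) (n + 1) :=
  permCount_last_ne_zero K11 n

lemma trivKer_symm_iff (n : ℕ) {t : ℕ} (ht : t < 11) (e : Bool) :
    TrivKer (fun i j => ind J11 (i + j) + if e then 1 else 0) (11 * n + t) (11 * n + t) ↔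
      detValue t t e false (U (n + squareShift t)) (V (n + squareShift t)) (W (n + 1)) ≠ 0 := by
  rw [← trivKer_iff_detValue (by omega) (by omega) (by revert t; decide) (by revert t; decide)
    (V_ne_zero _) (U_add_V_ne_zero _) (W_succ_ne_zero n)]
  simp [TrivKer]

lemma Y_eq_detValue (n : ℕ) {t : ℕ} (ht : t < 11) : (Y (11 * n + t) : ZMod 2) =
    detValue t t false false (U (n + squareShift t)) (V (n + squareShift t)) (W (n + 1)) := by
  refine zmod2_eq_of_ne_zero_iff ((permCount_self_ne_zero _ _).trans ?_)
  rw [← trivKer_symm_iff n ht]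
  simp

lemma X_eq_detValue (n : ℕ) {t : ℕ} (ht : t < 11) : (X (11 * n + t) : ZMod 2) =
    detValue t t true false (U (n + squareShift t)) (V (n + squareShift t)) (W (n + 1)) +
    detValue t t false false (U (n + squareShift t)) (V (n + squareShift t)) (W (n + 1)) := by
  have h : (X (11 * n + t) : ZMod 2) + Y (11 * n + t) =
      detValue t t true false (U (n + squareShift t)) (V (n + squareShift t)) (W (n + 1)) := by
    refine zmod2_eq_of_ne_zero_iff ((sum_permCount_ne_zero _ _).trans ?_)
    rw [← trivKer_symm_iff n ht]
    simp
  rw [← Y_eq_detValue n ht, ← h, CharTwo.add_cancel_right]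

lemma Z_eq_detValue (n : ℕ) {t : ℕ} (h0 : 0 < t) (ht : t < 12) : (Z (11 * n + t) : ZMod 2) =
    detValue (t - 1) t false true (U (n + squareShift t)) (V (n + squareShift t)) (W (n + 1)) := by
  obtain ⟨a, rfl⟩ : ∃ a, t = a + 1 := ⟨t - 1, by omega⟩
  have ha : a < 11 := by omega
  clear h0 ht
  refine zmod2_eq_of_ne_zero_iff ((permCount_last_ne_zero _ _).trans ?_)
  rw [add_tsub_cancel_right, ← trivKer_iff_detValue (by omega) (by omega) (by revert a; decide)
    (by revert a; decide) (V_ne_zero _) (U_add_V_ne_zero _) (W_succ_ne_zero n), trivKer_last_iff]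
  simp [add_assoc]

end Recurrences

end ApwenianEleven

/-- Recurrences mod 2 expressing `X, Y, Z` in terms of `U, V, W` (case `d = 11`). -/
theorem F11_recurrences_XYZ :
    ∀ n : ℕ, 1 ≤ n →
      X (11 * n) ≡ U n [MOD 2] ∧
      Y (11 * n) ≡ U n + V n [MOD 2] ∧
      X (11 * n + 1) ≡ W (n + 1) * (U n + V n) [MOD 2] ∧
      Y (11 * n + 1) ≡ V n * W (n + 1) [MOD 2] ∧
      X (11 * n + 2) ≡ U n * W (n + 1) [MOD 2] ∧
      Y (11 * n + 2) ≡ W (n + 1) * (U n + V n) [MOD 2] ∧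
      X (11 * n + 3) ≡ W (n + 1) * (U n + V n) [MOD 2] ∧
      Y (11 * n + 3) ≡ V n * W (n + 1) [MOD 2] ∧
      X (11 * n + 4) ≡ V n * W (n + 1) [MOD 2] ∧
      Y (11 * n + 4) ≡ U n * W (n + 1) [MOD 2] ∧
      X (11 * n + 5) ≡ U n * W (n + 1) [MOD 2] ∧
      Y (11 * n + 5) ≡ W (n + 1) * (U n + V n) [MOD 2] ∧
      X (11 * n + 6) ≡ U (n + 1) * W (n + 1) [MOD 2] ∧
      Y (11 * n + 6) ≡ W (n + 1) * (U (n + 1) + V (n + 1)) [MOD 2] ∧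
      X (11 * n + 7) ≡ V (n + 1) * W (n + 1) [MOD 2] ∧
      Y (11 * n + 7) ≡ U (n + 1) * W (n + 1) [MOD 2] ∧
      X (11 * n + 8) ≡ W (n + 1) * (U (n + 1) + V (n + 1)) [MOD 2] ∧
      Y (11 * n + 8) ≡ V (n + 1) * W (n + 1) [MOD 2] ∧
      X (11 * n + 9) ≡ U (n + 1) * W (n + 1) [MOD 2] ∧
      Y (11 * n + 9) ≡ W (n + 1) * (U (n + 1) + V (n + 1)) [MOD 2] ∧
      X (11 * n + 10) ≡ W (n + 1) * (U (n + 1) + V (n + 1)) [MOD 2] ∧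
      Y (11 * n + 10) ≡ V (n + 1) * W (n + 1) [MOD 2] ∧
      Z (11 * n) ≡ W n * (U n + V n + U n * V n) [MOD 2] ∧
      (∀ i : ℕ, 1 ≤ i → i ≤ 5 →
        Z (11 * n + i) ≡ W (n + 1) * (U n + V n + U n * V n) [MOD 2]) ∧
      Z (11 * n + 6) ≡ W (n + 1) [MOD 2] ∧
      (∀ i : ℕ, 7 ≤ i → i ≤ 10 →
        Z (11 * n + i) ≡ W (n + 1) * (U (n + 1) + V (n + 1) + U (n + 1) * V (n + 1)) [MOD 2]) := by
  intro n hn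
  have hX0 := ApwenianEleven.X_eq_detValue n (t := 0) (by decide)
  have hY0 := ApwenianEleven.Y_eq_detValue n (t := 0) (by decide)
  have hZ0 : (Z (11 * n) : ZMod 2) =
      ApwenianEleven.detValue 10 11 false true (U n) (V n) (W n) := by
    obtain ⟨k, rfl⟩ : ∃ k, n = k + 1 := ⟨n - 1, by omega⟩
    exact ApwenianEleven.Z_eq_detValue k (t := 11) (by decide) (by decide)
  rw [add_zero] at hX0 hY0
  simp only [← ZMod.natCast_eq_natCast_iff, Nat.cast_mul, Nat.cast_add]
  refine ⟨?_, ?_, ?_, ?_, ?_, ?_, ?_, ?_, ?_, ?_, ?_, ?_, ?_, ?_, ?_, ?_, ?_, ?_, ?_, ?_, ?_, ?_,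
    ?_, fun i h1 h2 => ?_, ?_, fun i h1 h2 => ?_⟩
  all_goals
    try interval_cases i
  all_goals
    simp only [hX0, hY0, hZ0, ApwenianEleven.X_eq_detValue n,
      ApwenianEleven.Y_eq_detValue n,
      ApwenianEleven.Z_eq_detValue n, Nat.reduceLT,
      ApwenianEleven.squareShift, Nat.reduceLeDiff, if_true, if_false, add_zero]
    generalize (U n : ZMod 2) = u, (V n : ZMod 2) = v, (W n : ZMod 2) = w,
      (U (n + 1) : ZMod 2) = u', (V (n + 1) : ZMod 2) = v', (W (n + 1) : ZMod 2) = w'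
    decide +kernel +revert
end

section
/- For the sets J and K associated with d = 11 and v = (1,−1,−1,1,−1,1,1,1,1,−1,−1), the following congruences hold modulo 2 for every n ≥ 1: U_{11n} ≡ X_n; V_{11n} ≡ X_n + Y_n; U_{11n+1} ≡ Y_nZ_{n+1}; V_{11n+1} ≡ X_nZ_{n+1}; U_{11n+2} ≡ X_nZ_{n+1}; V_{11n+2} ≡ Z_{n+1}(X_n + Y_n); U_{11n+3} ≡ Y_nZ_{n+1}; V_{11n+3} ≡ X_nZ_{n+1}; U_{11n+4} ≡ Z_{n+1}(X_n + Y_n); V_{11n+4} ≡ Y_nZ_{n+1}; U_{11n+5} ≡ X_nZ_{n+1}; V_{11n+5} ≡ Z_{n+1}(X_n + Y_n); U_{11n+6} ≡ X_{n+1}Z_{n+1}; V_{11n+6} ≡ Z_{n+1}(X_{n+1} + Y_{n+1}); U_{11n+7} ≡ Z_{n+1}(X_{n+1} + Y_{n+1}); V_{11n+7} ≡ Y_{n+1}Z_{n+1}; U_{11n+8} ≡ Y_{n+1}Z_{n+1}; V_{11n+8} ≡ X_{n+1}Z_{n+1}; U_{11n+9} ≡ X_{n+1}Z_{n+1}; V_{11n+9}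 ≡ Z_{n+1}(X_{n+1} + Y_{n+1}); U_{11n+10} ≡ Y_{n+1}Z_{n+1}; V_{11n+10} ≡ X_{n+1}Z_{n+1}; W_{11n} ≡ Z_n(X_n + Y_n + X_nY_n); W_{11n+i} ≡ Z_{n+1}(X_n + Y_n + X_nY_n) for i = 1,2,3,4,5; W_{11n+6} ≡ Z_{n+1}; W_{11n+i} ≡ Z_{n+1}(X_{n+1} + Y_{n+1} + X_{n+1}Y_{n+1}) for i = 7,8,9,10. -/
namespace F11

lemma add_ten_mem_J11 (t : ℕ) : 11 * t + 10 ∈ J11 ↔ t ∈ K11 := by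
  simp only [J11, K11, P11, Q11, Set.mem_union, Set.mem_ofPred_eq, Set.mem_insert_iff,
    Set.mem_singleton_iff]
  constructor
  · rintro (⟨n, k, p, hp, h⟩ | ⟨n, k, q, hq, h⟩)
    · right
      rcases k with _ | k
      · simp at h; omega
      · refine ⟨n, k, p, hp, ?_⟩
        have : (11 * n + p) * 11 ^ (2 * (k + 1)) = 11 * ((11 * n + p) * 11 ^ (2 * k + 1)) := by ring
        omega
    · left
      refine ⟨n, k, q, hq, ?_⟩
      have : (11 * n + q) * 11 ^ (2 * k + 1) = 11 * ((11 * n + q) * 11 ^ (2 * k)) := by ring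
      omega
  · rintro (⟨n, k, q, hq, h⟩ | ⟨n, k, p, hp, h⟩)
    · right
      refine ⟨n, k, q, hq, ?_⟩
      have : (11 * n + q) * 11 ^ (2 * k + 1) = 11 * ((11 * n + q) * 11 ^ (2 * k)) := by ring
      omega
    · left
      refine ⟨n, k + 1, p, hp, ?_⟩
      have : (11 * n + p) * 11 ^ (2 * (k + 1)) = 11 * ((11 * n + p) * 11 ^ (2 * k + 1)) := by ring
      omega

lemma add_ten_mem_K11 (t : ℕ) : 11 * t + 10 ∈ K11 ↔ t ∈ J11 := by
  simp only [J11, K11, P11, Q11, Set.mem_union, Set.mem_ofPred_eq, Set.mem_insert_iff,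
    Set.mem_singleton_iff]
  constructor
  · rintro (⟨n, k, p, hp, h⟩ | ⟨n, k, q, hq, h⟩)
    · right
      rcases k with _ | k
      · simp at h; omega
      · refine ⟨n, k, p, hp, ?_⟩
        have : (11 * n + p) * 11 ^ (2 * (k + 1)) = 11 * ((11 * n + p) * 11 ^ (2 * k + 1)) := by ring
        omega
    · left
      refine ⟨n, k, q, hq, ?_⟩
      have : (11 * n + q) * 11 ^ (2 * k + 1) = 11 * ((11 * n + q) * 11 ^ (2 * k)) := by ring
      omega
  · rintro (⟨n, k, q, hq, h⟩ | ⟨n, k, p, hp, h⟩)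
    · right
      refine ⟨n, k, q, hq, ?_⟩
      have : (11 * n + q) * 11 ^ (2 * k + 1) = 11 * ((11 * n + q) * 11 ^ (2 * k)) := by ring
      omega
    · left
      refine ⟨n, k + 1, p, hp, ?_⟩
      have : (11 * n + p) * 11 ^ (2 * (k + 1)) = 11 * ((11 * n + p) * 11 ^ (2 * k + 1)) := by ring
      omega

lemma mem_J11_of_mod_ne (t : ℕ) (ht : t % 11 ≠ 10) : t ∈ J11 ↔ (t + 1) % 11 ∈ P11 := by
  simp only [J11, P11, Q11, Set.mem_union, Set.mem_ofPred_eq, Set.mem_insert_iff,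
    Set.mem_singleton_iff]
  constructor
  · rintro (⟨n, k, p, hp, h⟩ | ⟨n, k, q, hq, h⟩)
    · rcases k with _ | k
      · simp at h; omega
      · have : (11 * n + p) * 11 ^ (2 * (k + 1)) = 11 * ((11 * n + p) * 11 ^ (2 * k + 1)) := by ring
        omega
    · have : (11 * n + q) * 11 ^ (2 * k + 1) = 11 * ((11 * n + q) * 11 ^ (2 * k)) := by ring
      omega
  · intro h
    exact Or.inl ⟨(t + 1) / 11, 0, (t + 1) % 11, h, by simp; omega⟩

lemma mem_K11_of_mod_ne (t : ℕ) (ht : t % 11 ≠ 10) : t ∈ K11 ↔ (t + 1) % 11 ∈ Q11 := by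
  simp only [K11, P11, Q11, Set.mem_union, Set.mem_ofPred_eq, Set.mem_insert_iff,
    Set.mem_singleton_iff]
  constructor
  · rintro (⟨n, k, p, hp, h⟩ | ⟨n, k, q, hq, h⟩)
    · rcases k with _ | k
      · simp at h; omega
      · have : (11 * n + p) * 11 ^ (2 * (k + 1)) = 11 * ((11 * n + p) * 11 ^ (2 * k + 1)) := by ring
        omega
    · have : (11 * n + q) * 11 ^ (2 * k + 1) = 11 * ((11 * n + q) * 11 ^ (2 * k)) := by ring
      omega
  · intro h
    exact Or.inl ⟨(t + 1) / 11, 0, (t + 1) % 11, h, by simp; omega⟩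

lemma mem_K11_iff_notMem_J11 (t : ℕ) : t ∈ K11 ↔ t ∉ J11 := by
  induction t using Nat.strong_induction_on with
  | _ t ih =>
    by_cases ht : t % 11 = 10
    · obtain ⟨s, rfl⟩ : ∃ s, t = 11 * s + 10 := ⟨t / 11, by omega⟩
      rw [add_ten_mem_J11, add_ten_mem_K11, ih s (by omega), not_not]
    · rw [mem_J11_of_mod_ne t ht, mem_K11_of_mod_ne t ht]
      simp only [P11, Q11, Set.mem_insert_iff, Set.mem_singleton_iff]
      omega

open Classical in
/-- The indicator sequence of `J11` over `ZMod 2`, shifted by the constant `f`; the shift by `1`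
is the indicator sequence of `K11`. -/
noncomputable def seq (f : ZMod 2) (t : ℕ) : ZMod 2 := (if t ∈ J11 then 1 else 0) + f

lemma seq_eq_add (f : ZMod 2) (t : ℕ) : seq f t = seq 0 t + f := by simp [seq]

open Classical in
lemma seq_zero (t : ℕ) : seq 0 t = if t ∈ J11 then 1 else 0 := by simp [seq]

open Classical in
lemma seq_one (t : ℕ) : seq 1 t = if t ∈ K11 then 1 else 0 := by
  rw [seq, mem_K11_iff_notMem_J11]
  split_ifs with h
  · decide
  · simp

/-- The value of `seq 0` in the residue class `e` modulo `11`, up to the contribution of `seq 0`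
itself when `e = 10`. -/
def residueBit (e : ℕ) : Bool := [0, 2, 3, 4, 8, 10].contains (e % 11)

/-- The element of `ZMod 2` with the given truth value. -/
def toZ (b : Bool) : ZMod 2 := if b then 1 else 0

lemma toZ_xor (a b : Bool) : toZ (a ^^ b) = toZ a + toZ b := by
  revert a b; decide

lemma toZ_and (a b : Bool) : toZ (a && b) = toZ a * toZ b := by
  revert a b; decide

lemma seq_block (f : Bool) (a b r s : ℕ) (hr : r < 11) (hs : s < 11) :
    seq (toZ f) (11 * a + r + (11 * b + s)) =
      toZ (f ^^ residueBit (r + s)) + if s = 10 - r then seq 0 (a + b) else 0 := by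
  rw [seq_eq_add, toZ_xor]
  by_cases h : s = 10 - r
  · rw [if_pos h]
    have e1 : 11 * a + r + (11 * b + s) = 11 * (a + b) + 10 := by omega
    have e2 : seq 0 (11 * (a + b) + 10) = seq 0 (a + b) + 1 := by
      rw [← seq_eq_add, seq_one, seq_zero, add_ten_mem_J11]
    have e3 : r + s = 10 := by omega
    rw [e1, e2, e3]
    have : toZ (residueBit 10) = 1 := by decide
    rw [this]; ring
  · rw [if_neg h]
    have h1 : (11 * a + r + (11 * b + s)) % 11 ≠ 10 := by omega
    have h2 : (11 * a + r + (11 * b + s)) % 11 = (r + s) % 11 := by omega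
    have h3 : (11 * a + r + (11 * b + s) + 1) % 11 = (r + s + 1) % 11 := by omega
    rw [seq_zero, mem_J11_of_mod_ne _ h1, h3]
    have h4 : (r + s + 1) % 11 ∈ P11 ↔ residueBit (r + s) = true := by
      simp only [P11, residueBit, Set.mem_insert_iff, Set.mem_singleton_iff, List.contains_eq_mem,
        List.mem_cons, List.not_mem_nil, decide_eq_true_eq, or_false]
      omega
    simp only [h4, toZ]
    ring

/-- The Hankel determinant of order `m` of `seq f`, with the row of index `l` replaced by ones
(no row is replaced if `m ≤ l`). -/
noncomputable def hankelDet (f : ZMod 2) (m l : ℕ) : ZMod 2 :=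
  (Matrix.of fun i j : Fin m => if (i : ℕ) = l then 1 else seq f (i + j)).det

lemma permCount_eq_det (S : Set ℕ) (s : ℕ → ZMod 2) (hs : ∀ t, t ∈ S → s t = 1)
    (hs' : ∀ t, t ∉ S → s t = 0) (m l : ℕ) :
    (permCount S m l : ZMod 2) =
      (Matrix.of fun i j : Fin m => if (i : ℕ) = l then 1 else s (i + j)).det := by
  classical
  rw [permCount, Nat.card_eq_fintype_card, Fintype.card_subtype, Finset.card_filter,
    ← Matrix.det_transpose, Matrix.det_apply]
  push_cast
  refine Finset.sum_congr rfl fun σ _ => ?_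
  have hsign : ∀ x : ZMod 2, Equiv.Perm.sign σ • x = x := by
    intro x
    rcases Int.units_eq_one_or (Equiv.Perm.sign σ) with h | h <;> rw [h]
    · simp
    · rw [Units.neg_smul, one_smul, ZMod.neg_eq_self_mod_two]
  rw [hsign]
  simp only [Matrix.transpose_apply, Matrix.of_apply]
  split_ifs with h
  · refine (Finset.prod_eq_one fun i _ => ?_).symm
    split_ifs with hi
    · rfl
    · exact hs _ (h i hi)
  · push Not at h
    obtain ⟨i, hi, hiS⟩ := h
    refine (Finset.prod_eq_zero (Finset.mem_univ i) ?_).symm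
    rw [if_neg hi, hs' _ hiS]

lemma permCount_J11 (m l : ℕ) : (permCount J11 m l : ZMod 2) = hankelDet 0 m l := by
  refine permCount_eq_det J11 (seq 0) (fun t h => ?_) (fun t h => ?_) m l <;> simp [seq_zero, h]

lemma permCount_K11 (m l : ℕ) : (permCount K11 m l : ZMod 2) = hankelDet 1 m l := by
  refine permCount_eq_det K11 (seq 1) (fun t h => ?_) (fun t h => ?_) m l <;> simp [seq_one, h]

lemma hankelDet_ne_zero_iff (f : ZMod 2) (m l : ℕ) :
    hankelDet f m l ≠ 0 ↔ ∀ v : ℕ → ZMod 2,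
      (∀ i < m, i ≠ l → ∑ j ∈ Finset.range m, seq f (i + j) * v j = 0) →
      (l < m → ∑ j ∈ Finset.range m, v j = 0) → ∀ j < m, v j = 0 := by
  rw [hankelDet, ne_eq, ← Matrix.exists_mulVec_eq_zero_iff]
  push Not
  constructor
  · intro H v h1 h2 j hj
    by_contra hv
    refine H (fun j => v j) (fun h => hv (congrFun h ⟨j, hj⟩)) ?_
    ext i
    simp only [Matrix.mulVec, dotProduct, Matrix.of_apply, Pi.zero_apply]
    by_cases hi : (i : ℕ) = l
    · simp only [hi, if_true, one_mul]
      rw [Fin.sum_univ_eq_sum_range (fun j => v j)]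
      exact h2 (hi ▸ i.2)
    · simp only [hi, if_false]
      rw [Fin.sum_univ_eq_sum_range (fun j => seq f (i + j) * v j)]
      exact h1 i i.2 hi
  · intro H v hv h0
    apply hv
    have key := H (fun j => if h : j < m then v ⟨j, h⟩ else 0) ?_ ?_
    · ext j
      simpa using key j j.2
    · intro i hi hil
      have := congrFun h0 ⟨i, hi⟩
      simp only [Matrix.mulVec, dotProduct, Matrix.of_apply, Pi.zero_apply, hil, if_false] at this
      rw [← Fin.sum_univ_eq_sum_range
        (fun j => seq f (i + j) * (if h : j < m then v ⟨j, h⟩ else 0))]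
      simpa using this
    · intro hl
      have := congrFun h0 ⟨l, hl⟩
      simp only [Matrix.mulVec, dotProduct, Matrix.of_apply, Pi.zero_apply, if_true, one_mul]
        at this
      rw [← Fin.sum_univ_eq_sum_range (fun j => (if h : j < m then v ⟨j, h⟩ else 0))]
      simpa using this

lemma sum_hankelDet (f : ZMod 2) (m : ℕ) :
    ∑ l ∈ Finset.range m, hankelDet f m l = hankelDet f m m + hankelDet (f + 1) m m := by
  let A : ℕ → Matrix (Fin m) (Fin m) (ZMod 2) := fun k =>
    Matrix.of fun i j => seq f (i + j) + if (i : ℕ) < k then 1 else 0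
  have step : ∀ k ≤ m, (A k).det = hankelDet f m m + ∑ l ∈ Finset.range k, hankelDet f m l := by
    intro k
    induction k with
    | zero =>
      intro _
      simp only [Finset.range_zero, Finset.sum_empty, add_zero, hankelDet, A]
      congr 1
      ext i j
      simp [i.2.ne]
    | succ k ih =>
      intro hk
      rw [Finset.sum_range_succ, ← add_assoc, ← ih (by omega)]
      have e : A (k + 1) = Matrix.updateRow (A k) ⟨k, hk⟩ (A k ⟨k, hk⟩ + fun _ => 1) := by
        ext i j
        by_cases hi : i = ⟨k, hk⟩
        · subst hi
          simp [A]
        · have : (i : ℕ) ≠ k := fun h => hi (Fin.ext h)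
          rw [Matrix.updateRow_ne hi]
          simp only [A, Matrix.of_apply]
          congr 2
          simp only [eq_iff_iff]
          omega
      rw [e, Matrix.det_updateRow_add, Matrix.updateRow_eq_self]
      congr 1
      rw [hankelDet]
      refine Matrix.det_eq_of_forall_row_eq_smul_add_const
        (fun i => if (i : ℕ) < k then 1 else 0) ⟨k, hk⟩ (by simp) fun i j => ?_
      by_cases hi : i = ⟨k, hk⟩
      · subst hi
        simp
      · have : (i : ℕ) ≠ k := fun h => hi (Fin.ext h)
        rw [Matrix.updateRow_ne hi]
        simp [A, this]
  have e : (A m).det = hankelDet (f + 1) m m := by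
    rw [hankelDet]
    congr 1
    ext i j
    simp only [A, Matrix.of_apply, i.2, i.2.ne, if_true, if_false]
    rw [seq_eq_add f, seq_eq_add (f + 1)]
    ring
  have := step m le_rfl
  rw [← e, this, ← add_assoc, CharTwo.add_self_eq_zero, zero_add]

/-- The dot product of row `a` of the Hankel matrix of `seq f` with the first `q` entries of `v`. -/
noncomputable def rowDot (f : ZMod 2) (q : ℕ) (v : ℕ → ZMod 2) (a : ℕ) : ZMod 2 :=
  ∑ b ∈ Finset.range q, seq f (a + b) * v b

/-- `ρ g t` describes the pairs such that some vector `v` of length `q` with entry sum `t` is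
mapped to the constant vector `g` by the `p × q` Hankel matrix of `seq 0`, and such a `v` is
unique. -/
structure BlockRel (p q : ℕ) (ρ : ZMod 2 → ZMod 2 → Prop) : Prop where
  exists_of_rel : ∀ g t, ρ g t →
    ∃ v : ℕ → ZMod 2, (∀ a < p, rowDot 0 q v a = g) ∧ ∑ b ∈ Finset.range q, v b = t
  rel : ∀ (v : ℕ → ZMod 2) g, (∀ a < p, rowDot 0 q v a = g) → ρ g (∑ b ∈ Finset.range q, v b)
  eq_zero : ∀ v : ℕ → ZMod 2, (∀ a < p, rowDot 0 q v a = 0) → ∑ b ∈ Finset.range q, v b = 0 →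
    ∀ b < q, v b = 0

/-- Some nonzero vector of length `q` has entry sum zero and is annihilated by the `p × q` Hankel
matrix of `seq 0`. -/
def BlockDegenerate (p q : ℕ) : Prop :=
  ∃ v : ℕ → ZMod 2, (∀ a < p, rowDot 0 q v a = 0) ∧ ∑ b ∈ Finset.range q, v b = 0 ∧
    ∃ b < q, v b ≠ 0

lemma eq_one_of_ne_zero {a : ZMod 2} (h : a ≠ 0) : a = 1 := by
  revert a; decide

lemma eq_of_add_eq_zero {a b : ZMod 2} (h : a + b = 0) : b = a := by
  revert a b; decide

lemma exists_solution {f : ZMod 2} {m l : ℕ} (h : hankelDet f m l ≠ 0) (w : ℕ → ZMod 2) :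
    ∃ v : ℕ → ZMod 2, (∀ i < m, i ≠ l → rowDot f m v i = w i) ∧
      (l < m → ∑ j ∈ Finset.range m, v j = w l) := by
  set A : Matrix (Fin m) (Fin m) (ZMod 2) :=
    Matrix.of fun i j : Fin m => if (i : ℕ) = l then 1 else seq f (i + j) with hA
  have hu : IsUnit A.det := isUnit_iff_ne_zero.mpr h
  set u := A⁻¹.mulVec (fun i : Fin m => w i) with hu_def
  have hAu : A.mulVec u = fun i : Fin m => w i := by
    rw [hu_def, Matrix.mulVec_mulVec, Matrix.mul_nonsing_inv _ hu, Matrix.one_mulVec]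
  refine ⟨fun j => if h : j < m then u ⟨j, h⟩ else 0, fun i hi hil => ?_, fun hl => ?_⟩
  · have := congrFun hAu ⟨i, hi⟩
    simp only [Matrix.mulVec, dotProduct, hA, Matrix.of_apply, hil, if_false] at this
    rw [rowDot, ← Fin.sum_univ_eq_sum_range
      (fun j => seq f (i + j) * (if h : j < m then u ⟨j, h⟩ else 0))]
    simpa using this
  · have := congrFun hAu ⟨l, hl⟩
    simp only [Matrix.mulVec, dotProduct, hA, Matrix.of_apply, if_true, one_mul] at this
    rw [← Fin.sum_univ_eq_sum_range (fun j => (if h : j < m then u ⟨j, h⟩ else 0))]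
    simpa using this

lemma eq_zero_of_vecMul {f : ZMod 2} {m l : ℕ} (h : hankelDet f m l ≠ 0) (u : ℕ → ZMod 2)
    (hu : ∀ j < m, ∑ i ∈ Finset.range m, u i * (if i = l then 1 else seq f (i + j)) = 0) :
    ∀ i < m, u i = 0 := by
  intro i hi
  by_contra hne
  refine h (Matrix.exists_vecMul_eq_zero_iff.mp ⟨fun i => u i, ?_, ?_⟩)
  · exact fun h0 => hne (congrFun h0 ⟨i, hi⟩)
  · ext j
    simp only [Matrix.vecMul, dotProduct, Matrix.of_apply, Pi.zero_apply]
    rw [Fin.sum_univ_eq_sum_range (fun i => u i * (if i = l then 1 else seq f (i + j)))]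
    exact hu j j.2

lemma blockRel_wide {N : ℕ} (h : hankelDet 0 (N + 1) N ≠ 0) :
    BlockRel N (N + 1) fun _ _ => True where
  exists_of_rel g t _ := by
    obtain ⟨v, h1, h2⟩ := exists_solution h fun i => if i = N then t else g
    refine ⟨v, fun a ha => ?_, ?_⟩
    · rw [h1 a (by omega) ha.ne, if_neg ha.ne]
    · rw [h2 (by omega), if_pos rfl]
  rel _ _ _ := trivial
  eq_zero v h1 h2 := (hankelDet_ne_zero_iff 0 (N + 1) N).mp h v
    (fun i hi hiN => h1 i (by omega)) fun _ => h2

lemma blockDegenerate_wide {N : ℕ} (h : hankelDet 0 (N + 1) N = 0) :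
    BlockDegenerate N (N + 1) := by
  have h' := mt (hankelDet_ne_zero_iff 0 (N + 1) N).mpr (not_not.mpr h)
  push Not at h'
  obtain ⟨v, h1, h2, b, hb, hv⟩ := h'
  exact ⟨v, fun a ha => h1 a (by omega) (by omega), h2 (by omega), b, hb, hv⟩

lemma blockRel_tall {N : ℕ} (h : hankelDet 0 (N + 1) N ≠ 0) :
    BlockRel (N + 1) N fun g t => g = 0 ∧ t = 0 := by
  have key : ∀ (v : ℕ → ZMod 2) g, (∀ a < N + 1, rowDot 0 N v a = g) →
      g = 0 ∧ ∀ b < N, v b = 0 := by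
    intro v g hv
    have := eq_zero_of_vecMul h (fun i => if i = N then g else v i) fun j hj => by
      have e : ∑ i ∈ Finset.range N, (if i = N then g else v i) *
          (if i = N then 1 else seq 0 (i + j)) = g := by
        rw [← hv j hj, rowDot]
        refine Finset.sum_congr rfl fun i hi => ?_
        have : i ≠ N := (Finset.mem_range.mp hi).ne
        rw [if_neg this, if_neg this, mul_comm, add_comm i j]
      rw [Finset.sum_range_succ, e, if_pos rfl, if_pos rfl, mul_one, CharTwo.add_self_eq_zero]
    refine ⟨by simpa using this N (by omega), fun b hb => ?_⟩
    simpa [hb.ne] using this b (by omega)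
  refine ⟨?_, fun v g hv => ?_, fun v hv _ => (key v 0 hv).2⟩
  · rintro g t ⟨rfl, rfl⟩
    exact ⟨fun _ => 0, by simp [rowDot], by simp⟩
  · obtain ⟨hg, h0⟩ := key v g hv
    exact ⟨hg, Finset.sum_eq_zero fun b hb => h0 b (Finset.mem_range.mp hb)⟩

lemma rowDot_eq_add (f : ZMod 2) (q : ℕ) (v : ℕ → ZMod 2) (a : ℕ) :
    rowDot f q v a = rowDot 0 q v a + f * ∑ b ∈ Finset.range q, v b := by
  rw [rowDot, rowDot, Finset.mul_sum, ← Finset.sum_add_distrib]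
  refine Finset.sum_congr rfl fun b _ => ?_
  rw [seq_eq_add]; ring

lemma rowDot_sub_smul (f : ZMod 2) (q : ℕ) (v u : ℕ → ZMod 2) (c : ZMod 2) (a : ℕ) :
    rowDot f q (fun b => v b - c * u b) a = rowDot f q v a - c * rowDot f q u a := by
  simp only [rowDot, Finset.mul_sum, ← Finset.sum_sub_distrib]
  exact Finset.sum_congr rfl fun b _ => by ring

lemma rowDot_smul (f : ZMod 2) (q : ℕ) (u : ℕ → ZMod 2) (c : ZMod 2) (a : ℕ) :
    rowDot f q (fun b => c * u b) a = c * rowDot f q u a := by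
  simp only [rowDot, Finset.mul_sum]
  exact Finset.sum_congr rfl fun b _ => by ring

lemma eq_zero_of_rowDot {f : ZMod 2} {n : ℕ} (h : hankelDet f n n ≠ 0) (v : ℕ → ZMod 2)
    (hv : ∀ a < n, rowDot f n v a = 0) : ∀ b < n, v b = 0 :=
  (hankelDet_ne_zero_iff f n n).mp h v (fun i hi _ => hv i hi) fun h => absurd h (lt_irrefl n)

lemma exists_rowDot_eq_zero {f : ZMod 2} {n : ℕ} (h : hankelDet f n n = 0) :
    ∃ v : ℕ → ZMod 2, (∀ a < n, rowDot f n v a = 0) ∧ ∃ b < n, v b ≠ 0 := by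
  have h' := mt (hankelDet_ne_zero_iff f n n).mpr (not_not.mpr h)
  push Not at h'
  obtain ⟨v, h1, -, b, hb, hv⟩ := h'
  exact ⟨v, fun a ha => h1 a ha ha.ne, b, hb, hv⟩

/-- If the Hankel matrix of `seq f` is nonsingular, then the preimage of the constant vector `1`
has entry sum `1 + hankelDet (f + 1) n n`. -/
lemma exists_preimage_one {f : ZMod 2} {n : ℕ} (h : hankelDet f n n ≠ 0) :
    ∃ u : ℕ → ZMod 2, (∀ a < n, rowDot f n u a = 1) ∧
      (∑ b ∈ Finset.range n, u b = 1 + hankelDet (f + 1) n n) ∧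
      ∀ v g, (∀ a < n, rowDot f n v a = g) → ∀ b < n, v b = g * u b := by
  obtain ⟨u, hu, -⟩ := exists_solution h fun _ => 1
  have hu : ∀ a < n, rowDot f n u a = 1 := fun a ha => hu a ha ha.ne
  have huniq : ∀ v g, (∀ a < n, rowDot f n v a = g) → ∀ b < n, v b = g * u b := by
    intro v g hv b hb
    refine sub_eq_zero.mp (eq_zero_of_rowDot h (fun b => v b - g * u b) (fun a ha => ?_) b hb)
    rw [rowDot_sub_smul, hv a ha, hu a ha, mul_one, sub_self]
  have hshift : ∀ v a, rowDot (f + 1) n v a = rowDot f n v a + ∑ b ∈ Finset.range n, v b := by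
    intro v a
    rw [rowDot_eq_add (f + 1), rowDot_eq_add f]; ring
  refine ⟨u, hu, ?_, huniq⟩
  by_cases h1 : hankelDet (f + 1) n n = 0
  · obtain ⟨v, hv, b, hb, hvb⟩ := exists_rowDot_eq_zero h1
    have hv' := huniq v (∑ b ∈ Finset.range n, v b) fun a ha =>
      (eq_of_add_eq_zero (hshift v a ▸ hv a ha)).symm
    have hs : ∑ b ∈ Finset.range n, v b ≠ 0 := fun h0 => hvb (by rw [hv' b hb, h0, zero_mul])
    have hs := eq_one_of_ne_zero hs
    rw [h1, add_zero, ← hs]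
    refine Finset.sum_congr rfl fun b hb => ?_
    rw [hv' b (Finset.mem_range.mp hb), hs, one_mul]
  · rw [eq_one_of_ne_zero h1, CharTwo.add_self_eq_zero]
    by_contra hs
    have h0 := eq_zero_of_rowDot h1 u fun a ha => by
      rw [hshift, hu a ha, eq_one_of_ne_zero hs, CharTwo.add_self_eq_zero]
    exact hs (Finset.sum_eq_zero fun b hb => h0 b (Finset.mem_range.mp hb))

lemma blockRel_square {n : ℕ} (h : hankelDet 0 n n ≠ 0 ∨ hankelDet 1 n n ≠ 0) :
    BlockRel n n fun g t =>
      hankelDet 0 n n * t = (hankelDet 0 n n + hankelDet 1 n n) * g := by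
  by_cases h0 : hankelDet 0 n n = 0
  · have h1 := h.resolve_left (not_not.mpr h0)
    obtain ⟨u, hu, hs, huniq⟩ := exists_preimage_one h1
    have e : (1 : ZMod 2) + 1 = 0 := by decide
    rw [e, h0, add_zero] at hs
    rw [h0, eq_one_of_ne_zero h1]
    simp only [zero_mul, zero_add, one_mul]
    have key : ∀ (v : ℕ → ZMod 2) g, (∀ a < n, rowDot 0 n v a = g) → g = 0 := by
      intro v g hv
      have h2 := huniq v (g + ∑ b ∈ Finset.range n, v b) fun a ha => by
        rw [rowDot_eq_add, hv a ha, one_mul]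
      have h3 : ∑ b ∈ Finset.range n, v b = g + ∑ b ∈ Finset.range n, v b := by
        conv_lhs => rw [Finset.sum_congr rfl fun b hb => h2 b (Finset.mem_range.mp hb),
          ← Finset.mul_sum, hs, mul_one]
      simpa using h3
    refine ⟨?_, fun v g hv => (key v g hv).symm, fun v hv hv0 => ?_⟩
    · rintro g t rfl
      refine ⟨fun b => t * u b, fun a ha => ?_, by rw [← Finset.mul_sum, hs, mul_one]⟩
      rw [rowDot_smul]
      have := rowDot_eq_add 1 n u a
      rw [hu a ha, hs, one_mul] at this
      rw [show rowDot 0 n u a = 0 by simpa using this, mul_zero]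
    · exact eq_zero_of_rowDot h1 v fun a ha => by rw [rowDot_eq_add, hv a ha, hv0]; simp
  · obtain ⟨u, hu, hs, huniq⟩ := exists_preimage_one h0
    rw [zero_add] at hs
    rw [eq_one_of_ne_zero h0]
    simp only [one_mul]
    refine ⟨?_, fun v g hv => ?_, fun v hv _ => eq_zero_of_rowDot h0 v hv⟩
    · rintro g t rfl
      refine ⟨fun b => g * u b, fun a ha => by rw [rowDot_smul, hu a ha, mul_one], ?_⟩
      rw [← Finset.mul_sum, hs, mul_comm]
    · rw [Finset.sum_congr rfl fun b hb => huniq v g hv b (Finset.mem_range.mp hb),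
        ← Finset.mul_sum, hs, mul_comm]

lemma sum_mul_rowDot_comm (f : ZMod 2) (n : ℕ) (v w : ℕ → ZMod 2) :
    ∑ a ∈ Finset.range n, w a * rowDot f n v a = ∑ a ∈ Finset.range n, v a * rowDot f n w a := by
  simp only [rowDot, Finset.mul_sum]
  rw [Finset.sum_comm]
  refine Finset.sum_congr rfl fun a _ => Finset.sum_congr rfl fun b _ => ?_
  rw [add_comm b a]; ring

lemma blockDegenerate_square {n : ℕ} (h0 : hankelDet 0 n n = 0) (h1 : hankelDet 1 n n = 0) :
    BlockDegenerate n n := by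
  obtain ⟨v, hv, b, hb, hvb⟩ := exists_rowDot_eq_zero h0
  obtain ⟨w, hw, c, hc, hwc⟩ := exists_rowDot_eq_zero h1
  by_cases hsv : ∑ b ∈ Finset.range n, v b = 0
  · exact ⟨v, hv, hsv, b, hb, hvb⟩
  have hw' : ∀ a < n, rowDot 0 n w a = ∑ b ∈ Finset.range n, w b := fun a ha => by
    have := hw a ha
    rw [rowDot_eq_add, one_mul] at this
    exact (eq_of_add_eq_zero this).symm
  by_cases hsw : ∑ b ∈ Finset.range n, w b = 0
  · exact ⟨w, fun a ha => by rw [hw' a ha, hsw], hsw, c, hc, hwc⟩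
  refine absurd (sum_mul_rowDot_comm 0 n v w) ?_
  rw [Finset.sum_eq_zero fun a ha => by rw [hv a (Finset.mem_range.mp ha), mul_zero],
    Finset.sum_congr rfl fun a ha => by rw [hw' a (Finset.mem_range.mp ha)], ← Finset.sum_mul]
  exact (mul_ne_zero hsv hsw).symm

lemma sum_range_eleven_mul_add (N i : ℕ) (hi : i ≤ 11) (F : ℕ → ZMod 2) :
    ∑ j ∈ Finset.range (11 * N + i), F j =
      ∑ s ∈ Finset.range 11, ∑ b ∈ Finset.range (N + (decide (s < i)).toNat), F (11 * b + s) := by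
  have h1 : ∀ N, ∑ j ∈ Finset.range (11 * N), F j =
      ∑ s ∈ Finset.range 11, ∑ b ∈ Finset.range N, F (11 * b + s) := by
    intro N
    induction N with
    | zero => simp
    | succ N ih =>
      simp only [Finset.sum_range_succ _ N, Finset.sum_add_distrib]
      rw [← ih, Nat.mul_succ, Finset.sum_range_add]
  rw [Finset.sum_range_add, h1, ← Nat.add_sub_cancel' hi, Finset.sum_range_add, Finset.sum_range_add,
    add_right_comm, ← Finset.sum_add_distrib]
  congr 1
  · refine Finset.sum_congr rfl fun s hs => ?_
    rw [decide_eq_true (by have := Finset.mem_range.mp hs; omega), Bool.toNat_true,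
      Finset.sum_range_succ]
  · refine Finset.sum_congr rfl fun s hs => ?_
    rw [decide_eq_false (by omega), Bool.toNat_false, add_zero]

lemma sum_seq_row (f : Bool) (N i a r : ℕ) (hi : i ≤ 11) (hr : r < 11) (v : ℕ → ZMod 2) :
    ∑ j ∈ Finset.range (11 * N + i), seq (toZ f) (11 * a + r + j) * v j =
      ∑ s ∈ Finset.range 11, toZ (f ^^ residueBit (r + s)) *
        ∑ b ∈ Finset.range (N + (decide (s < i)).toNat), v (11 * b + s) +
      rowDot 0 (N + (decide (10 - r < i)).toNat) (fun b => v (11 * b + (10 - r))) a := by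
  have h : rowDot 0 (N + (decide (10 - r < i)).toNat) (fun b => v (11 * b + (10 - r))) a =
      ∑ s ∈ Finset.range 11, if s = 10 - r then
        rowDot 0 (N + (decide (s < i)).toNat) (fun b => v (11 * b + s)) a else 0 := by
    rw [Finset.sum_ite_eq' (Finset.range 11) (10 - r), if_pos (Finset.mem_range.mpr (by omega))]
  rw [sum_range_eleven_mul_add N i hi, h, ← Finset.sum_add_distrib]
  refine Finset.sum_congr rfl fun s hs => ?_
  rw [Finset.mul_sum]
  split_ifs with hsr
  · rw [rowDot, ← Finset.sum_add_distrib]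
    refine Finset.sum_congr rfl fun b _ => ?_
    rw [seq_block f a b r s hr (Finset.mem_range.mp hs), if_pos hsr]; ring
  · rw [add_zero]
    refine Finset.sum_congr rfl fun b _ => ?_
    rw [seq_block f a b r s hr (Finset.mem_range.mp hs), if_neg hsr, add_zero]

lemma hankelDet_ne_zero_iff_residues (f : Bool) (N i i' : ℕ) (hi : i ≤ 11) (hi' : i' ≤ i)
    (hii' : i ≤ i' + 1) :
    hankelDet (toZ f) (11 * N + i) (11 * N + i') ≠ 0 ↔ ∀ v : ℕ → ZMod 2,
      (∀ r < 11, ∀ a < N + (decide (r < i')).toNat,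
        ∑ s ∈ Finset.range 11, toZ (f ^^ residueBit (r + s)) *
          ∑ b ∈ Finset.range (N + (decide (s < i)).toNat), v (11 * b + s) +
        rowDot 0 (N + (decide (10 - r < i)).toNat) (fun b => v (11 * b + (10 - r))) a = 0) →
      (i' < i → ∑ s ∈ Finset.range 11,
        ∑ b ∈ Finset.range (N + (decide (s < i)).toNat), v (11 * b + s) = 0) →
      ∀ s < 11, ∀ b < N + (decide (s < i)).toNat, v (11 * b + s) = 0 := by
  have hlt : ∀ j r a, r < 11 → j ≤ 11 →
      (a < N + (decide (r < j)).toNat ↔ 11 * a + r < 11 * N + j) := by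
    intro j r a hr hj
    by_cases h : r < j <;> simp [h] <;> omega
  rw [hankelDet_ne_zero_iff]
  refine forall_congr' fun v => ?_
  refine imp_congr ?_ (imp_congr ?_ ?_)
  · constructor
    · intro h r hr a ha
      rw [hlt i' r a hr (by omega)] at ha
      rw [← sum_seq_row f N i a r hi hr v]
      exact h _ (by omega) (by omega)
    · intro h k hk hkl
      have := h (k % 11) (by omega) (k / 11)
        ((hlt i' (k % 11) (k / 11) (by omega) (by omega)).mpr (by omega))
      rw [← sum_seq_row f N i _ _ hi (by omega) v, Nat.div_add_mod] at this
      exact this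
  · rw [sum_range_eleven_mul_add N i hi]
    exact imp_congr (by omega) Iff.rfl
  · constructor
    · intro h s hs b hb
      exact h _ ((hlt i s b hs hi).mp hb)
    · intro h j hj
      have := h (j % 11) (by omega) (j / 11)
        ((hlt i (j % 11) (j / 11) (by omega) hi).mpr (by omega))
      rwa [Nat.div_add_mod] at this

lemma hankelDet_ne_zero_iff_forall_rel (f : Bool) (N i i' : ℕ) (hi : i ≤ 11) (hi' : i' ≤ i)
    (hii' : i ≤ i' + 1) (ρ : ℕ → ZMod 2 → ZMod 2 → Prop)
    (hρ : ∀ r < 11,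
      BlockRel (N + (decide (r < i')).toNat) (N + (decide (10 - r < i)).toNat) (ρ r)) :
    hankelDet (toZ f) (11 * N + i) (11 * N + i') ≠ 0 ↔ ∀ t : ℕ → ZMod 2,
      (∀ r < 11, ρ r (∑ s ∈ Finset.range 11, toZ (f ^^ residueBit (r + s)) * t s) (t (10 - r))) →
      (i' < i → ∑ s ∈ Finset.range 11, t s = 0) → ∀ s < 11, t s = 0 := by
  rw [hankelDet_ne_zero_iff_residues f N i i' hi hi' hii']
  constructor
  · intro H t ht hsum
    choose V hV1 hV2 using fun (r : ℕ) (hr : r < 11) => (hρ r hr).exists_of_rel _ _ (ht r hr)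
    let v : ℕ → ZMod 2 := fun j => V (10 - j % 11) (by omega) (j / 11)
    have hv : ∀ s (hs : s < 11), (fun b => v (11 * b + s)) = V (10 - s) (by omega) := by
      intro s hs
      funext b
      simp only [v]
      have e1 : (11 * b + s) % 11 = s := by omega
      have e2 : (11 * b + s) / 11 = b := by omega
      simp only [e1, e2]
    have hvs : ∀ s < 11, ∑ b ∈ Finset.range (N + (decide (s < i)).toNat), v (11 * b + s) = t s := by
      intro s hs
      have h := hV2 (10 - s) (by omega)
      rw [Nat.sub_sub_self (by omega)] at h
      rw [← h]
      exact Finset.sum_congr rfl fun b _ => congrFun (hv s hs) b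
    have h0 := H v (fun r hr a ha => ?_) (fun hlt => ?_)
    · intro s hs
      rw [← hvs s hs]
      exact Finset.sum_eq_zero fun b hb => h0 s hs b (Finset.mem_range.mp hb)
    · have h1 : (fun b => v (11 * b + (10 - r))) = V r hr := by
        rw [hv (10 - r) (by omega)]
        congr 1
        omega
      rw [h1, hV1 r hr a ha,
        Finset.sum_congr rfl fun s hs => by rw [hvs s (Finset.mem_range.mp hs)],
        CharTwo.add_self_eq_zero]
    · rw [Finset.sum_congr rfl fun s hs => hvs s (Finset.mem_range.mp hs)]
      exact hsum hlt
  · intro H v hv hsum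
    have h0 := H (fun s => ∑ b ∈ Finset.range (N + (decide (s < i)).toNat), v (11 * b + s))
      (fun r hr => (hρ r hr).rel (fun b => v (11 * b + (10 - r))) _
        fun a ha => eq_of_add_eq_zero (hv r hr a ha)) hsum
    intro s hs
    have h1 := (hρ (10 - s) (by omega)).eq_zero (fun b => v (11 * b + (10 - (10 - s))))
      (fun a ha => ?_) (h0 _ (by omega))
    · rwa [Nat.sub_sub_self (by omega)] at h1
    · rw [eq_of_add_eq_zero (hv (10 - s) (by omega) a ha)]
      exact Finset.sum_eq_zero fun s hs => by rw [h0 s (Finset.mem_range.mp hs), mul_zero]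

lemma hankelDet_eq_zero_of_blockDegenerate (f : Bool) (N i i' : ℕ) (hi : i ≤ 11) (hi' : i' ≤ i)
    (hii' : i ≤ i' + 1) (r : ℕ) (hr : r < 11)
    (h : BlockDegenerate (N + (decide (r < i')).toNat) (N + (decide (10 - r < i)).toNat)) :
    hankelDet (toZ f) (11 * N + i) (11 * N + i') = 0 := by
  by_contra hne
  rw [← ne_eq, hankelDet_ne_zero_iff_residues f N i i' hi hi' hii'] at hne
  obtain ⟨w, hw, hsum, b, hb, hwb⟩ := h
  let v : ℕ → ZMod 2 := fun j => if j % 11 = 10 - r then w (j / 11) else 0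
  have hv : ∀ s < 11, ∀ b, v (11 * b + s) = if s = 10 - r then w b else 0 := by
    intro s hs b
    simp only [v]
    have e1 : (11 * b + s) % 11 = s := by omega
    have e2 : (11 * b + s) / 11 = b := by omega
    rw [e1, e2]
  have hvs : ∀ s < 11, ∑ b ∈ Finset.range (N + (decide (s < i)).toNat), v (11 * b + s) = 0 := by
    intro s hs
    simp only [hv s hs]
    split_ifs with h
    · rw [h, hsum]
    · simp
  refine hwb ?_
  have := hne v (fun r' hr' a ha => ?_)
    (fun _ => Finset.sum_eq_zero fun s hs => hvs s (Finset.mem_range.mp hs))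
    (10 - r) (by omega) b hb
  · rwa [hv _ (by omega), if_pos rfl] at this
  · rw [Finset.sum_eq_zero fun s hs => by rw [hvs s (Finset.mem_range.mp hs), mul_zero], zero_add]
    simp only [hv (10 - r') (by omega)]
    split_ifs with h
    · have : r' = r := by omega
      subst this
      exact hw a ha
    · simp [rowDot]

/-- The entry in position `k` of the linear combination of the binary vectors encoded by the list
`cs`, with coefficients `t`. -/
def combination : List ℕ → (ℕ → ZMod 2) → ℕ → ZMod 2
  | [], _, _ => 0
  | c :: cs, t, k => toZ (c.testBit k) * t 0 + combination cs (fun s => t (s + 1)) k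

/-- Add `c` to `d` if `d` has a one in the leading position of `c`. -/
def clearBit (c d : ℕ) : ℕ := if d.testBit c.log2 then d ^^^ c else d

/-- Gaussian elimination, deciding linear independence of a list of at most `n` binary vectors. -/
def independent : ℕ → List ℕ → Bool
  | _, [] => true
  | 0, _ :: _ => false
  | _ + 1, 0 :: _ => false
  | n + 1, (c + 1) :: cs => independent n (cs.map (clearBit (c + 1)))

lemma toZ_testBit_clearBit (c d j : ℕ) : toZ ((clearBit c d).testBit j) =
    toZ (d.testBit j) + toZ (d.testBit c.log2) * toZ (c.testBit j) := by
  rw [clearBit]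
  split_ifs with h
  · rw [Nat.testBit_xor, toZ_xor, h]
    simp [toZ]
  · simp [h, toZ]

lemma combination_map_clearBit (c : ℕ) (cs : List ℕ) (t : ℕ → ZMod 2) (j : ℕ) :
    combination (cs.map (clearBit c)) t j =
      combination cs t j + combination cs t c.log2 * toZ (c.testBit j) := by
  induction cs generalizing t with
  | nil => simp [combination]
  | cons d cs ih =>
    rw [List.map_cons, combination, combination, combination, ih, toZ_testBit_clearBit]
    ring

lemma independent_iff (n : ℕ) (cs : List ℕ) (hn : cs.length ≤ n) : independent n cs = true ↔
    ∀ t : ℕ → ZMod 2, (∀ k, combination cs t k = 0) → ∀ s < cs.length, t s = 0 := by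
  induction n generalizing cs with
  | zero =>
    obtain rfl : cs = [] := List.length_eq_zero_iff.mp (by omega)
    simp [independent]
  | succ n ih =>
    match cs with
    | [] => simp [independent]
    | 0 :: cs =>
      simp only [independent, Bool.false_eq_true, false_iff]
      intro H
      have := H (fun s => if s = 0 then 1 else 0) (fun k => ?_) 0 (by simp)
      · simp at this
      · have h0 : ∀ (cs : List ℕ) k, combination cs (fun _ => 0) k = 0 := by
          intro cs
          induction cs with
          | nil => simp [combination]
          | cons c cs ih => simp [combination, ih]
        simp [combination, h0, toZ]
    | (c + 1) :: cs =>
      have hbit : toZ ((c + 1).testBit (c + 1).log2) = 1 := by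
        rw [Nat.testBit_log2 (by omega)]; rfl
      rw [independent, ih _ (by simpa using hn), List.length_map]
      simp only [combination_map_clearBit]
      constructor
      · intro H t ht
        simp only [combination] at ht
        have hlead := ht (c + 1).log2
        rw [hbit, one_mul] at hlead
        have h0 := H (fun s => t (s + 1)) fun k => by
          rw [eq_of_add_eq_zero hlead, mul_comm, add_comm]
          exact ht k
        intro s hs
        rcases s with _ | s
        · have hc : ∀ (cs : List ℕ) (t : ℕ → ZMod 2) k, (∀ s < cs.length, t s = 0) →
              combination cs t k = 0 := by
            intro cs
            induction cs with
            | nil => simp [combination]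
            | cons c cs ih =>
              intro t k h
              rw [combination, h 0 (by simp), ih _ _ fun s hs => h (s + 1) (by simpa using hs)]
              simp
          rw [hc cs _ _ h0, add_zero] at hlead
          exact hlead
        · exact h0 s (by simpa using hs)
      · intro H t ht s hs
        have := H (fun s => s.casesOn (combination cs t (c + 1).log2) t) (fun k => ?_) (s + 1)
          (by simpa using hs)
        · exact this
        · rw [combination, mul_comm, add_comm]
          exact ht k

lemma combination_ofFn (n : ℕ) (c : Fin n → ℕ) (t : ℕ → ZMod 2) (k : ℕ) :
    combination (List.ofFn c) t k = ∑ s : Fin n, toZ ((c s).testBit k) * t s := by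
  induction n generalizing t with
  | zero => simp [combination]
  | succ n ih => rw [List.ofFn_succ, combination, ih, Fin.sum_univ_succ]; simp

/-- The coefficients of the linear system for the residue class sums `t s` of a kernel vector of
the Hankel matrix of order `11 * N + i`; `x` and `y` are the invariants of the square blocks, and
`i' < i` means that the row of index `11 * N + i'` is replaced by ones. -/
def coefficient (f x y : Bool) (i i' k s : ℕ) : Bool :=
  if k = 22 then decide (i' < i)
  else
    let r := k / 2
    if decide (r < i') = decide (10 - r < i) then
      k % 2 = 0 && ((y && s = 10 - r) ^^ (x && (f ^^ residueBit (r + s))))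
    else if r < i' then
      if k % 2 = 0 then f ^^ residueBit (r + s) else s = 10 - r
    else false

/-- Whether the linear system given by `coefficient` has only the trivial solution. -/
def systemNonsingular (f x y : Bool) (i i' : ℕ) : Bool :=
  independent 11 (List.ofFn fun s : Fin 11 =>
    Nat.ofBits fun k : Fin 23 => coefficient f x y i i' k s)

/-- The constraint imposed on the `r`-th block. -/
def blockConstraint (x y : Bool) (i i' r : ℕ) (g t : ZMod 2) : Prop :=
  if decide (r < i') = decide (10 - r < i) then toZ y * t = toZ x * g
  else if r < i' then g = 0 ∧ t = 0 else True

lemma systemNonsingular_iff (f x y : Bool) (i i' : ℕ) :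
    systemNonsingular f x y i i' = true ↔ ∀ t : ℕ → ZMod 2,
      (∀ r < 11, blockConstraint x y i i' r
        (∑ s ∈ Finset.range 11, toZ (f ^^ residueBit (r + s)) * t s) (t (10 - r))) →
      (i' < i → ∑ s ∈ Finset.range 11, t s = 0) → ∀ s < 11, t s = 0 := by
  rw [systemNonsingular, independent_iff _ _ (by simp)]
  refine forall_congr' fun t => ?_
  rw [List.length_ofFn, ← and_imp]
  refine imp_congr ?_ Iff.rfl
  have hcomb : (∀ k, combination (List.ofFn fun s : Fin 11 =>
      Nat.ofBits fun k : Fin 23 => coefficient f x y i i' k s) t k = 0) ↔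
      ∀ k < 23, ∑ s ∈ Finset.range 11, toZ (coefficient f x y i i' k s) * t s = 0 := by
    refine forall_congr' fun k => ?_
    rw [combination_ofFn]
    by_cases hk : k < 23
    · simp only [Nat.testBit_ofBits_lt _ _ hk, hk, true_imp_iff]
      rw [Fin.sum_univ_eq_sum_range (fun s => toZ (coefficient f x y i i' k s) * t s)]
    · simp [Nat.testBit_ofBits_ge _ _ (not_lt.mp hk), hk, toZ]
  have hsingle : ∀ r < 11, ∑ s ∈ Finset.range 11, toZ (decide (s = 10 - r)) * t s = t (10 - r) := by
    intro r hr
    simp only [toZ, decide_eq_true_eq, ite_mul, one_mul, zero_mul]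
    rw [Finset.sum_ite_eq' (Finset.range 11) (10 - r), if_pos (Finset.mem_range.mpr (by omega))]
  have hblock : ∀ r < 11, blockConstraint x y i i' r
      (∑ s ∈ Finset.range 11, toZ (f ^^ residueBit (r + s)) * t s) (t (10 - r)) ↔
      ∑ s ∈ Finset.range 11, toZ (coefficient f x y i i' (2 * r) s) * t s = 0 ∧
      ∑ s ∈ Finset.range 11, toZ (coefficient f x y i i' (2 * r + 1) s) * t s = 0 := by
    intro r hr
    have e1 : 2 * r / 2 = r := by omega
    have e2 : (2 * r + 1) / 2 = r := by omega
    have e3 : 2 * r % 2 = 0 := by omega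
    have e4 : (2 * r + 1) % 2 = 1 := by omega
    have e5 : 2 * r ≠ 22 := by omega
    have e6 : 2 * r + 1 ≠ 22 := by omega
    simp only [blockConstraint, coefficient, e1, e2, e3, e4, if_neg e5, if_neg e6, one_ne_zero,
      if_true, if_false, decide_true, decide_false, Bool.true_and, Bool.false_and]
    split_ifs with h1 h2
    · have e7 : ∑ s ∈ Finset.range 11, toZ ((y && decide (s = 10 - r)) ^^
          (x && (f ^^ residueBit (r + s)))) * t s =
          toZ y * t (10 - r) +
            toZ x * ∑ s ∈ Finset.range 11, toZ (f ^^ residueBit (r + s)) * t s := by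
        rw [← hsingle r hr, Finset.mul_sum, Finset.mul_sum, ← Finset.sum_add_distrib]
        refine Finset.sum_congr rfl fun s _ => ?_
        rw [toZ_xor, toZ_and, toZ_and]
        ring
      rw [e7]
      simp [toZ, CharTwo.add_eq_zero]
    · simp only [hsingle r hr]
    · simp [toZ]
  rw [hcomb]
  constructor
  · intro h
    refine ⟨fun r hr => (hblock r hr).mpr ⟨h _ (by omega), h _ (by omega)⟩, fun hlt => ?_⟩
    have := h 22 (by omega)
    simpa [coefficient, hlt, toZ] using this
  · rintro ⟨h1, h2⟩ k hk
    rcases Nat.even_or_odd' k with ⟨r, rfl | rfl⟩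
    · by_cases hr : r < 11
      · exact ((hblock r hr).mp (h1 r hr)).1
      · obtain rfl : r = 11 := by omega
        by_cases hlt : i' < i
        · simpa [coefficient, hlt, toZ] using h2 hlt
        · simp [coefficient, hlt, toZ]
    · exact ((hblock r (by omega)).mp (h1 r (by omega))).2

/-- The Hankel determinant of order `11 * N + i` in terms of the invariants `x`, `y` of the square
blocks and `z` of the other blocks. -/
def determinantBit (f x y z : Bool) (i i' : ℕ) : Bool :=
  (z || (List.range 11).all fun r => decide (r < i') || !decide (10 - r < i)) &&
  (x || y || (List.range 11).all fun r => decide (r < i') != decide (10 - r < i)) &&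
  systemNonsingular f x y i i'

lemma hankelDet_eq_determinantBit (f x y z : Bool) (N M i i' : ℕ) (hi : i ≤ 11) (hi' : i' ≤ i)
    (hii' : i ≤ i' + 1)
    (htall : ∀ r < 11, r < i' → ¬ 10 - r < i → ∃ r' < 11, ¬ r' < i' ∧ 10 - r' < i)
    (hsq : ∀ r < 11, decide (r < i') = decide (10 - r < i) → N + (decide (r < i')).toNat = M)
    (hy : hankelDet 0 M M = toZ y) (hx : hankelDet 0 M M + hankelDet 1 M M = toZ x)
    (hz : hankelDet 0 (N + 1) N = toZ z) :
    hankelDet (toZ f) (11 * N + i) (11 * N + i') = toZ (determinantBit f x y z i i') := by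
  have h01 : ∀ b : Bool, toZ b = 0 ↔ b = false := by decide
  have hone : hankelDet 1 M M = toZ x + toZ y := by
    rw [← hx, hy, add_right_comm, CharTwo.add_self_eq_zero, zero_add]
  rw [determinantBit]
  by_cases hwide : z = false ∧ ∃ r < 11, ¬ r < i' ∧ 10 - r < i
  · obtain ⟨hz0, r, hr, h1, h2⟩ := hwide
    rw [hankelDet_eq_zero_of_blockDegenerate f N i i' hi hi' hii' r hr]
    · have : ((List.range 11).all fun r => decide (r < i') || !decide (10 - r < i)) = false := by
        rw [List.all_eq_false]
        exact ⟨r, by simpa using hr, by simp [h1, h2]⟩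
      rw [this, hz0]
      rfl
    · rw [decide_eq_false h1, decide_eq_true h2]
      exact blockDegenerate_wide (N := N) (by rw [hz, hz0]; rfl)
  by_cases hsquare : (x = false ∧ y = false) ∧ ∃ r < 11, decide (r < i') = decide (10 - r < i)
  · obtain ⟨⟨hx0, hy0⟩, r, hr, h1⟩ := hsquare
    rw [hankelDet_eq_zero_of_blockDegenerate f N i i' hi hi' hii' r hr]
    · have : ((List.range 11).all fun r => decide (r < i') != decide (10 - r < i)) = false := by
        rw [List.all_eq_false]
        exact ⟨r, by simpa using hr, by simp [h1]⟩
      rw [this, hx0, hy0]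
      simp [toZ]
    · rw [← h1, hsq r hr h1]
      exact blockDegenerate_square (by rw [hy, hy0]; rfl) (by rw [hone, hx0, hy0]; rfl)
  have hwide_all : (z || (List.range 11).all fun r => decide (r < i') || !decide (10 - r < i)) =
      true := by
    rw [Bool.or_eq_true, List.all_eq_true]
    by_contra hcon
    push Not at hcon
    obtain ⟨hz0, r, hr, h⟩ := hcon
    exact hwide ⟨by simpa using hz0, r, by simpa using hr, by simpa using h⟩
  have hsquare_all :
      (x || y || (List.range 11).all fun r => decide (r < i') != decide (10 - r < i)) = true := by
    rw [Bool.or_eq_true, List.all_eq_true]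
    by_contra hcon
    push Not at hcon
    obtain ⟨hxy, r, hr, h⟩ := hcon
    exact hsquare ⟨by simpa using hxy, r, by simpa using hr, by simpa using h⟩
  rw [hwide_all, hsquare_all, Bool.true_and, Bool.true_and]
  have hz' : (∃ r < 11, ¬ r < i' ∧ 10 - r < i) → hankelDet 0 (N + 1) N ≠ 0 := by
    intro h h0
    exact hwide ⟨(h01 z).mp (hz ▸ h0), h⟩
  have hρ : ∀ r < 11, BlockRel (N + (decide (r < i')).toNat) (N + (decide (10 - r < i)).toNat)
      (blockConstraint x y i i' r) := by
    intro r hr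
    by_cases h1 : decide (r < i') = decide (10 - r < i)
    · have e : blockConstraint x y i i' r = fun g t =>
          hankelDet 0 M M * t = (hankelDet 0 M M + hankelDet 1 M M) * g := by
        funext g t
        rw [blockConstraint, if_pos h1, hy, hone, add_left_comm, CharTwo.add_self_eq_zero,
          add_zero]
      rw [e, ← h1, hsq r hr h1]
      apply blockRel_square
      by_contra hcon
      push Not at hcon
      rw [hy, h01, hone] at hcon
      obtain ⟨hy0, hx0⟩ := hcon
      rw [hy0] at hx0
      exact hsquare ⟨⟨(h01 x).mp (by simpa [toZ] using hx0), hy0⟩, r, hr, h1⟩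
    · by_cases h2 : r < i'
      · have h3 : ¬ 10 - r < i := fun h3 => h1 (by simp [h2, h3])
        have e : blockConstraint x y i i' r = fun g t => g = 0 ∧ t = 0 := by
          funext g t
          rw [blockConstraint, if_neg h1, if_pos h2]
        rw [e, decide_eq_true h2, decide_eq_false h3]
        exact blockRel_tall (hz' (htall r hr h2 h3))
      · have h3 : 10 - r < i := by
          by_contra h3
          exact h1 (by simp [h2, h3])
        have e : blockConstraint x y i i' r = fun g t => True := by
          funext g t
          rw [blockConstraint, if_neg h1, if_neg h2]
        rw [e, decide_eq_false h2, decide_eq_true h3]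
        exact blockRel_wide (hz' ⟨r, hr, h2, h3⟩)
  have key := hankelDet_ne_zero_iff_forall_rel f N i i' hi hi' hii' _ hρ
  rw [← systemNonsingular_iff f x y i i'] at key
  cases hs : systemNonsingular f x y i i'
  · rw [hs] at key
    by_contra hne
    exact absurd (key.mp hne) (by simp)
  · exact eq_one_of_ne_zero (key.mpr hs)

lemma exists_toZ (a : ZMod 2) : ∃ b : Bool, a = toZ b := by
  revert a; decide

lemma X_cast (n : ℕ) : (X n : ZMod 2) = hankelDet 0 n n + hankelDet 1 n n := by
  rw [X, Nat.cast_sum, Finset.sum_congr rfl fun l _ => permCount_J11 n l, sum_hankelDet, zero_add]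

lemma U_cast (n : ℕ) : (U n : ZMod 2) = hankelDet 0 n n + hankelDet 1 n n := by
  rw [U, Nat.cast_sum, Finset.sum_congr rfl fun l _ => permCount_K11 n l, sum_hankelDet, add_comm]
  rfl

lemma Y_cast (n : ℕ) : (Y n : ZMod 2) = hankelDet 0 n n := permCount_J11 n n

lemma V_cast (n : ℕ) : (V n : ZMod 2) = hankelDet 1 n n := permCount_K11 n n

lemma Z_cast (n : ℕ) : (Z (n + 1) : ZMod 2) = hankelDet 0 (n + 1) n := permCount_J11 (n + 1) n

lemma W_cast (n : ℕ) : (W n : ZMod 2) = hankelDet 1 n (n - 1) := permCount_K11 n (n - 1)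

/-- The values of `U`, `V` and `W` at `11 * N + i` as functions of `X` and `Y` at `M` and of `Z` at
`N + 1`, where `M` is the order of the square blocks. -/
lemma UVW_cast (N M i : ℕ) (hi : 1 ≤ i) (hi' : i ≤ 11) (hM : M = N + (decide (6 ≤ i)).toNat)
    {x y z : Bool} (hx : (X M : ZMod 2) = toZ x) (hy : (Y M : ZMod 2) = toZ y)
    (hz : (Z (N + 1) : ZMod 2) = toZ z) :
    (U (11 * N + i) : ZMod 2) =
        toZ (determinantBit false x y z i i) + toZ (determinantBit true x y z i i) ∧
      (V (11 * N + i) : ZMod 2) = toZ (determinantBit true x y z i i) ∧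
      (W (11 * N + i) : ZMod 2) = toZ (determinantBit true x y z i (i - 1)) := by
  rw [X_cast] at hx
  rw [Y_cast] at hy
  rw [Z_cast] at hz
  have hdet : ∀ f, hankelDet (toZ f) (11 * N + i) (11 * N + i) =
      toZ (determinantBit f x y z i i) := fun f =>
    hankelDet_eq_determinantBit f x y z N M i i hi' le_rfl (by omega)
      (fun r hr h1 h2 => ⟨10 - r, by omega, h2, by omega⟩)
      (fun r hr h => by
        rw [hM]
        congr 2
        rw [decide_eq_decide] at h ⊢
        omega)
      hy hx hz
  have hdet' : hankelDet (toZ true) (11 * N + i) (11 * N + (i - 1)) =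
      toZ (determinantBit true x y z i (i - 1)) :=
    hankelDet_eq_determinantBit true x y z N M i (i - 1) hi' (by omega) (by omega)
      (fun r hr h1 h2 => ⟨10 - r, by omega, by omega, by omega⟩)
      (fun r hr h => by
        rw [hM]
        congr 2
        rw [decide_eq_decide] at h ⊢
        omega)
      hy hx hz
  rw [U_cast, V_cast, W_cast, Nat.add_sub_assoc hi]
  exact ⟨congrArg₂ (· + ·) (hdet false) (hdet true), hdet true, hdet'⟩

end F11

/-- Recurrences mod 2 expressing `U, V, W` in terms of `X, Y, Z` (case `d = 11`). -/
theorem F11_recurrences_UVW :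
    ∀ n : ℕ, 1 ≤ n →
      U (11 * n) ≡ X n [MOD 2] ∧
      V (11 * n) ≡ X n + Y n [MOD 2] ∧
      U (11 * n + 1) ≡ Y n * Z (n + 1) [MOD 2] ∧
      V (11 * n + 1) ≡ X n * Z (n + 1) [MOD 2] ∧
      U (11 * n + 2) ≡ X n * Z (n + 1) [MOD 2] ∧
      V (11 * n + 2) ≡ Z (n + 1) * (X n + Y n) [MOD 2] ∧
      U (11 * n + 3) ≡ Y n * Z (n + 1) [MOD 2] ∧
      V (11 * n + 3) ≡ X n * Z (n + 1) [MOD 2] ∧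
      U (11 * n + 4) ≡ Z (n + 1) * (X n + Y n) [MOD 2] ∧
      V (11 * n + 4) ≡ Y n * Z (n + 1) [MOD 2] ∧
      U (11 * n + 5) ≡ X n * Z (n + 1) [MOD 2] ∧
      V (11 * n + 5) ≡ Z (n + 1) * (X n + Y n) [MOD 2] ∧
      U (11 * n + 6) ≡ X (n + 1) * Z (n + 1) [MOD 2] ∧
      V (11 * n + 6) ≡ Z (n + 1) * (X (n + 1) + Y (n + 1)) [MOD 2] ∧
      U (11 * n + 7) ≡ Z (n + 1) * (X (n + 1) + Y (n + 1)) [MOD 2] ∧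
      V (11 * n + 7) ≡ Y (n + 1) * Z (n + 1) [MOD 2] ∧
      U (11 * n + 8) ≡ Y (n + 1) * Z (n + 1) [MOD 2] ∧
      V (11 * n + 8) ≡ X (n + 1) * Z (n + 1) [MOD 2] ∧
      U (11 * n + 9) ≡ X (n + 1) * Z (n + 1) [MOD 2] ∧
      V (11 * n + 9) ≡ Z (n + 1) * (X (n + 1) + Y (n + 1)) [MOD 2] ∧
      U (11 * n + 10) ≡ Y (n + 1) * Z (n + 1) [MOD 2] ∧
      V (11 * n + 10) ≡ X (n + 1) * Z (n + 1) [MOD 2] ∧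
      W (11 * n) ≡ Z n * (X n + Y n + X n * Y n) [MOD 2] ∧
      (∀ i : ℕ, 1 ≤ i → i ≤ 5 →
        W (11 * n + i) ≡ Z (n + 1) * (X n + Y n + X n * Y n) [MOD 2]) ∧
      W (11 * n + 6) ≡ Z (n + 1) [MOD 2] ∧
      (∀ i : ℕ, 7 ≤ i → i ≤ 10 →
        W (11 * n + i) ≡ Z (n + 1) * (X (n + 1) + Y (n + 1) + X (n + 1) * Y (n + 1)) [MOD 2]) := by
  intro n hn
  obtain ⟨x, hx⟩ := F11.exists_toZ (X n)
  obtain ⟨y, hy⟩ := F11.exists_toZ (Y n)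
  obtain ⟨z, hz⟩ := F11.exists_toZ (Z n)
  obtain ⟨x', hx'⟩ := F11.exists_toZ (X (n + 1))
  obtain ⟨y', hy'⟩ := F11.exists_toZ (Y (n + 1))
  obtain ⟨z', hz'⟩ := F11.exists_toZ (Z (n + 1))
  have low : ∀ i, 1 ≤ i → i ≤ 5 → _ := fun i h1 h5 =>
    F11.UVW_cast n n i h1 (by omega) (by rw [decide_eq_false (by omega)]; rfl) hx hy hz'
  have high : ∀ i, 6 ≤ i → i ≤ 10 → _ := fun i h6 h10 =>
    F11.UVW_cast n (n + 1) i (by omega) (by omega) (by rw [decide_eq_true h6]; rfl) hx' hy' hz'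
  obtain ⟨u0, v0, w0⟩ : (U (11 * n) : ZMod 2) =
        F11.toZ (F11.determinantBit false x y z 11 11) +
          F11.toZ (F11.determinantBit true x y z 11 11) ∧
      (V (11 * n) : ZMod 2) = F11.toZ (F11.determinantBit true x y z 11 11) ∧
      (W (11 * n) : ZMod 2) = F11.toZ (F11.determinantBit true x y z 11 10) := by
    obtain ⟨N, rfl⟩ : ∃ N, n = N + 1 := ⟨n - 1, by omega⟩
    exact F11.UVW_cast N (N + 1) 11 (by omega) (by omega) rfl hx hy hz
  obtain ⟨u1, v1, w1⟩ := low 1 (by norm_num) (by norm_num)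
  obtain ⟨u2, v2, w2⟩ := low 2 (by norm_num) (by norm_num)
  obtain ⟨u3, v3, w3⟩ := low 3 (by norm_num) (by norm_num)
  obtain ⟨u4, v4, w4⟩ := low 4 (by norm_num) (by norm_num)
  obtain ⟨u5, v5, w5⟩ := low 5 (by norm_num) (by norm_num)
  obtain ⟨u6, v6, w6⟩ := high 6 (by norm_num) (by norm_num)
  obtain ⟨u7, v7, w7⟩ := high 7 (by norm_num) (by norm_num)
  obtain ⟨u8, v8, w8⟩ := high 8 (by norm_num) (by norm_num)
  obtain ⟨u9, v9, w9⟩ := high 9 (by norm_num) (by norm_num)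
  obtain ⟨u10, v10, w10⟩ := high 10 (by norm_num) (by norm_num)
  simp only [← ZMod.natCast_eq_natCast_iff]
  push_cast
  rw [hx, hy, hz, hx', hy', hz', u0, v0, u1, v1, u2, v2, u3, v3, u4, v4, u5, v5, u6, v6, u7, v7,
    u8, v8, u9, v9, u10, v10, w0, w6]
  refine ⟨?_, ?_, ?_, ?_, ?_, ?_, ?_, ?_, ?_, ?_, ?_, ?_, ?_, ?_, ?_, ?_, ?_, ?_, ?_, ?_, ?_, ?_, ?_,
    fun i h1 h5 => ?_, ?_, fun i h7 h10 => ?_⟩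
  on_goal 26 => interval_cases i <;> [rw [w7]; rw [w8]; rw [w9]; rw [w10]]
  on_goal 24 => interval_cases i <;> [rw [w1]; rw [w2]; rw [w3]; rw [w4]; rw [w5]]
  all_goals
    clear * - x y z x' y' z'
    revert x y z x' y' z'
    decide +kernel
end

section
/- For the sets J and K associated with d = 11 and v = (1,−1,−1,1,−1,1,1,1,1,−1,−1), with T_n = X_n + X_nY_n + Y_n and R_n = U_n + U_nV_n + V_n, the following congruences hold modulo 2 for every n ≥ 1: T_{11n} ≡ R_n; R_{11n} ≡ T_n; T_{11n+i} ≡ R_nW_{n+1} and R_{11n+i} ≡ T_nZ_{n+1} for 1 ≤ i ≤ 5; T_{11n+i} ≡ R_{n+1}W_{n+1} and R_{11n+i} ≡ T_{n+1}Z_{n+1} for 6 ≤ i ≤ 10; Z_{11n} ≡ R_nW_n; W_{11n} ≡ T_nZ_n; Z_{11n+i} ≡ R_nW_{n+1} and W_{11n+i} ≡ T_nZ_{n+1} for 1 ≤ i ≤ 5; Z_{11n+6} ≡ W_{n+1}; W_{11n+6} ≡ Z_{n+1}; Z_{11n+i} ≡ R_{n+1}W_{n+1} and W_{11n+i} ≡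 T_{n+1}Z_{n+1} for 7 ≤ i ≤ 10. -/
noncomputable def T (n : ℕ) : ℕ := X n + X n * Y n + Y n
noncomputable def R (n : ℕ) : ℕ := U n + U n * V n + V n

open Finset Matrix

/-- The `m × m` Hankel matrix of `h` over `ZMod 2`, with row `l` replaced by ones. -/
def hankelOnes (h : ℕ → ZMod 2) (m l : ℕ) : Matrix (Fin m) (Fin m) (ZMod 2) :=
  Matrix.of fun i j => if (i : ℕ) = l then 1 else h (i + j)

/-- The only vector of length `b` with zero sum that is killed by the first `a` rows of the Hankel
matrix of `h` is zero. -/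
def HankelNondeg (h : ℕ → ZMod 2) (a b : ℕ) : Prop :=
  ∀ v : Fin b → ZMod 2, ∑ j, v j = 0 → (∀ i < a, ∑ j : Fin b, h (i + j) * v j = 0) → v = 0

lemma permCount_cast (S : Set ℕ) (m l : ℕ) :
    (permCount S m l : ZMod 2) = (hankelOnes (S.indicator 1) m l).det := by
  classical
  rw [← Matrix.det_transpose, Matrix.det_apply, permCount, Nat.card_eq_fintype_card,
    Fintype.card_subtype, Finset.card_filter, Nat.cast_sum]
  refine Finset.sum_congr rfl fun σ _ => ?_
  have hs : ∀ x : ZMod 2, Equiv.Perm.sign σ • x = x := fun x => by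
    rcases Int.units_eq_one_or (Equiv.Perm.sign σ) with h | h <;> rw [h]
    · simp
    · rw [Units.neg_smul, one_smul, ZMod.neg_eq_self_mod_two]
  rw [hs]
  split_ifs with h
  · rw [Nat.cast_one, Finset.prod_eq_one]
    intro i _
    by_cases hi : (i : ℕ) = l
    · simp [hankelOnes, hi]
    · simp [hankelOnes, hi, h i hi]
  · push Not at h
    obtain ⟨i, hi, hS⟩ := h
    rw [Nat.cast_zero, Finset.prod_eq_zero (Finset.mem_univ i)]
    simp [hankelOnes, hi, hS]

lemma hankelOnes_mulVec_eq_zero {h : ℕ → ZMod 2} {m l : ℕ} {v : Fin m → ZMod 2} :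
    hankelOnes h m l *ᵥ v = 0 ↔ ∀ i : Fin m,
      if (i : ℕ) = l then ∑ j, v j = 0 else ∑ j : Fin m, h (i + j) * v j = 0 := by
  rw [funext_iff]
  refine forall_congr' fun i => ?_
  by_cases hi : (i : ℕ) = l <;> simp [hankelOnes, Matrix.mulVec, dotProduct, hi]

lemma hankelNondeg_pred_iff (h : ℕ → ZMod 2) {n : ℕ} (hn : 1 ≤ n) :
    HankelNondeg h (n - 1) n ↔ (hankelOnes h n (n - 1)).det ≠ 0 := by
  rw [Ne, ← Matrix.exists_mulVec_eq_zero_iff, HankelNondeg]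
  push Not
  refine forall_congr' fun v => ?_
  rw [Ne, Ne, hankelOnes_mulVec_eq_zero]
  constructor
  · intro H hv hM
    refine hv (H (by simpa using hM ⟨n - 1, by omega⟩) fun i hi => ?_)
    simpa [show i ≠ n - 1 by omega] using hM ⟨i, by omega⟩
  · intro H hs hM
    by_contra hv
    refine H hv fun i => ?_
    split_ifs with hi
    · exact hs
    · exact hM i (by omega)

lemma hankel_pairing_comm (h : ℕ → ZMod 2) {a b : ℕ} (v : Fin a → ZMod 2) (w : Fin b → ZMod 2) :
    ∑ i, v i * ∑ j : Fin b, h (i + j) * w j = ∑ j, w j * ∑ i : Fin a, h (j + i) * v i := by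
  simp only [Finset.mul_sum]
  rw [Finset.sum_comm]
  refine Finset.sum_congr rfl fun j _ => Finset.sum_congr rfl fun i _ => ?_
  rw [add_comm (j : ℕ)]
  ring

lemma hankelNondeg_self_iff (h : ℕ → ZMod 2) (n : ℕ) :
    HankelNondeg h n n ↔
      ¬ (∑ l ∈ range n, (hankelOnes h n l).det = 0 ∧ (hankelOnes h n n).det = 0) := by
  have hne : ∀ i : Fin n, (i : ℕ) ≠ n := fun i => i.isLt.ne
  constructor
  · rintro H ⟨hX, hY⟩
    obtain ⟨v, hv0, hv⟩ := Matrix.exists_mulVec_eq_zero_iff.2 hY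
    have hrow : ∀ l : Fin n, hankelOnes h n l = (hankelOnes h n n).updateRow l 1 := by
      intro l
      ext i j
      simp only [hankelOnes, Matrix.updateRow_apply, Matrix.of_apply, Fin.ext_iff, hne, if_false,
        Pi.one_apply]
    have hT : (hankelOnes h n n)ᵀ = hankelOnes h n n := by
      ext i j
      simp [hankelOnes, hne, add_comm]
    have hc : ∀ l : Fin n, (hankelOnes h n n).cramer 1 l = (hankelOnes h n l).det := fun l => by
      rw [hrow, ← Matrix.cramer_transpose_apply, hT]
    have hk : hankelOnes h n n *ᵥ (hankelOnes h n n).cramer 1 = 0 := by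
      rw [Matrix.mulVec_cramer, hY, zero_smul]
    rw [hankelOnes_mulVec_eq_zero] at hv hk
    simp only [hne, if_false] at hv hk
    have hw : (hankelOnes h n n).cramer 1 = 0 := by
      refine H _ ?_ fun i hi => hk ⟨i, hi⟩
      rw [← hX, Finset.sum_range]
      exact Finset.sum_congr rfl fun l _ => hc l
    obtain ⟨l, hl⟩ := Function.ne_iff.1 hv0
    have hdet : (hankelOnes h n l).det = 0 := by rw [← hc, hw, Pi.zero_apply]
    obtain ⟨u, hu0, hu⟩ := Matrix.exists_mulVec_eq_zero_iff.2 hdet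
    rw [hankelOnes_mulVec_eq_zero] at hu
    have hu' : ∀ i : Fin n, i ≠ l → ∑ j : Fin n, h (i + j) * u j = 0 := fun i hi => by
      simpa [Fin.val_inj, hi] using hu i
    refine hu0 (H u (by simpa using hu l) fun i hi => ?_)
    by_cases hil : (⟨i, hi⟩ : Fin n) = l
    · have hp := hankel_pairing_comm h v u
      simp only [hv, mul_zero, Finset.sum_const_zero] at hp
      rw [Finset.sum_eq_single l (fun i _ hi => by rw [hu' i hi, mul_zero]) (by simp)] at hp
      have := (mul_eq_zero.1 hp).resolve_left hl
      rwa [← hil] at this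
    · exact hu' _ hil
  · intro H v hs hv
    by_contra hv0
    refine H ⟨Finset.sum_eq_zero fun l _ => ?_, ?_⟩ <;>
    · refine Matrix.exists_mulVec_eq_zero_iff.1 ⟨v, hv0, hankelOnes_mulVec_eq_zero.2 fun i => ?_⟩
      split_ifs
      exacts [hs, hv i i.isLt]

/-- The part of the indicator of `J11` at `11 * c + t` that does not depend on `c`. -/
def residueTerm (t : ℕ) : ZMod 2 :=
  if (t + 1) % 11 ∈ ({0, 1, 3, 4, 5, 9} : Finset ℕ) then 1 else 0

set_option maxHeartbeats 4000000 in
lemma residue_system_rigid {p q : ℕ} (hp : p ≤ 5) (hq : q ≤ p + 1) {α β : ZMod 2}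
    (hαβ : α ≠ 0 ∨ β ≠ 0) (σ : ℕ → ZMod 2) (hσ : ∑ s ∈ range 11, σ s = 0)
    (hlow : ∀ r < p, σ (10 - r) = 0 ∧ ∑ s ∈ range 11, residueTerm (r + s) * σ s = 0)
    (hmid : ∀ r, p ≤ r → r + q < 11 →
      β * σ (10 - r) = α * ∑ s ∈ range 11, residueTerm (r + s) * σ s) :
    ∀ s < 11, σ s = 0 := by
  have hmid' : ∀ r, p ≤ r → r < 10 - p →
      β * σ (10 - r) = α * ∑ s ∈ range 11, residueTerm (r + s) * σ s := fun r h₁ h₂ =>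
    hmid r h₁ (by omega)
  have hαβ' : (α = 0 ∧ β = 1) ∨ (α = 1 ∧ β = 0) ∨ (α = 1 ∧ β = 1) := by
    revert hαβ
    clear hmid hmid'
    revert α β
    decide
  clear hmid hαβ hq
  suffices h : σ 0 = 0 ∧ σ 1 = 0 ∧ σ 2 = 0 ∧ σ 3 = 0 ∧ σ 4 = 0 ∧ σ 5 = 0 ∧ σ 6 = 0 ∧ σ 7 = 0 ∧
      σ 8 = 0 ∧ σ 9 = 0 ∧ σ 10 = 0 by
    intro s hs
    interval_cases s <;> tauto
  have l0 := hlow 0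
  have l1 := hlow 1
  have l2 := hlow 2
  have l3 := hlow 3
  have l4 := hlow 4
  have h0 := hmid' 0
  have h1 := hmid' 1
  have h2 := hmid' 2
  have h3 := hmid' 3
  have h4 := hmid' 4
  have h5 := hmid' 5
  have h6 := hmid' 6
  have h7 := hmid' 7
  have h8 := hmid' 8
  have h9 := hmid' 9
  clear hmid' hlow
  simp only [Finset.sum_range_succ, Finset.sum_range_zero,
    residueTerm] at hσ l0 l1 l2 l3 l4 h0 h1 h2 h3 h4 h5 h6 h7 h8 h9
  norm_num at hσ l0 l1 l2 l3 l4 h0 h1 h2 h3 h4 h5 h6 h7 h8 h9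
  generalize σ 0 = x0, σ 1 = x1, σ 2 = x2, σ 3 = x3, σ 4 = x4, σ 5 = x5, σ 6 = x6, σ 7 = x7,
    σ 8 = x8, σ 9 = x9, σ 10 = x10 at *
  clear σ
  obtain ⟨rfl, rfl⟩ | ⟨rfl, rfl⟩ | ⟨rfl, rfl⟩ := hαβ' <;> interval_cases p <;>
  · norm_num at l0 l1 l2 l3 l4 h0 h1 h2 h3 h4 h5 h6 h7 h8 h9
    grind

lemma sum_fin_eq_sum_range_of_support {f : ℕ → ZMod 2} {m L : ℕ} (hmL : m ≤ L)
    (hf : ∀ j, m ≤ j → f j = 0) : ∑ j : Fin m, f j = ∑ j ∈ range L, f j := by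
  rw [← Finset.sum_range]
  refine Finset.sum_subset (by simpa using hmL) fun j _ hj => hf j (by simpa using hj)

lemma sum_range_eleven_mul (f : ℕ → ZMod 2) (L : ℕ) :
    ∑ j ∈ range (11 * L), f j = ∑ s ∈ range 11, ∑ b ∈ range L, f (11 * b + s) := by
  rw [Finset.sum_comm]
  induction L with
  | zero => simp
  | succ L ih =>
    rw [mul_add, mul_one, Finset.sum_range_add, ih]
    exact (Finset.sum_range_succ _ L).symm

/-- The solutions `v` of `H v = κ 1`, for a Hankel matrix `H`, have their pairs `(∑ v, κ)` on a
common line. -/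
lemma hankel_solution_line (h : ℕ → ZMod 2) (m : ℕ) : ∃ α β : ZMod 2, (α ≠ 0 ∨ β ≠ 0) ∧
    ∀ (v : Fin m → ZMod 2) (κ : ZMod 2), (∀ i < m, ∑ j : Fin m, h (i + j) * v j = κ) →
      β * ∑ j, v j = α * κ := by
  by_cases hex : ∃ (w : Fin m → ZMod 2) (μ : ZMod 2),
      (∀ i < m, ∑ j : Fin m, h (i + j) * w j = μ) ∧ (∑ j, w j ≠ 0 ∨ μ ≠ 0)
  · obtain ⟨w, μ, hw, hne⟩ := hex
    refine ⟨∑ j, w j, μ, hne, fun v κ hv => ?_⟩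
    have hp := hankel_pairing_comm h v w
    simp only [hw _ (Fin.isLt _), hv _ (Fin.isLt _), ← Finset.sum_mul] at hp
    rw [mul_comm, hp]
  · push Not at hex
    refine ⟨1, 0, Or.inl one_ne_zero, fun v κ hv => ?_⟩
    rw [(hex v κ hv).2]
    simp

lemma HankelNondeg.eq_zero_of_transpose {h : ℕ → ZMod 2} {a b : ℕ} (H : HankelNondeg h b a)
    (hab : a = b + 1) {v : Fin b → ZMod 2} {κ : ZMod 2}
    (hv : ∀ i < a, ∑ j : Fin b, h (i + j) * v j = κ) : v = 0 ∧ κ = 0 := by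
  subst hab
  have hdet := (hankelNondeg_pred_iff h (Nat.le_add_left 1 b)).1 H
  rw [Nat.add_sub_cancel, Ne, ← Matrix.exists_vecMul_eq_zero_iff] at hdet
  push Not at hdet
  have hw : (Fin.snoc v κ : Fin (b + 1) → ZMod 2) = 0 := by
    by_contra hne
    refine hdet _ hne (funext fun j => ?_)
    have hj := hv j j.isLt
    simp only [Matrix.vecMul, dotProduct, Fin.sum_univ_castSucc, Fin.snoc_castSucc, Fin.snoc_last,
      hankelOnes, Matrix.of_apply, Fin.val_castSucc, Fin.val_last, if_true, mul_one,
      (Fin.isLt _).ne, if_false, Pi.zero_apply]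
    rw [← hj, ← Finset.sum_add_distrib]
    refine Finset.sum_eq_zero fun i _ => ?_
    rw [mul_comm, add_comm (i : ℕ), CharTwo.add_self_eq_zero]
  constructor
  · funext i
    simpa using congrFun hw i.castSucc
  · simpa using congrFun hw (Fin.last b)

/-- The number of `a` with `11 * a + r < N`, for `r ≤ 10`. -/
def blockSize (N r : ℕ) : ℕ := (N + 10 - r) / 11

lemma lt_blockSize_iff {N r a : ℕ} (_hr : r < 11) :
    a < blockSize N r ↔ 11 * a + r < N := by
  unfold blockSize
  omega

/-- `h` satisfies the same recurrence modulo `11` as the indicator of `J11`. -/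
structure ElevenRecurrence (h : ℕ → ZMod 2) : Prop where
  residue : ∀ c t, t < 10 → h (11 * c + t) = residueTerm t
  carry : ∀ c, h (11 * c + 10) = 1 + h c

namespace ElevenRecurrence

variable {h : ℕ → ZMod 2}

lemma apply_add (hh : ElevenRecurrence h) {r s : ℕ} (hr : r < 11) (hs : s < 11) (a b : ℕ) :
    h (11 * a + r + (11 * b + s)) =
      residueTerm (r + s) + if s = 10 - r then h (a + b) else 0 := by
  rcases lt_trichotomy (r + s) 10 with hlt | heq | hgt
  · rw [show 11 * a + r + (11 * b + s) = 11 * (a + b) + (r + s) by ring, hh.residue _ _ hlt,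
      if_neg (by omega), add_zero]
  · rw [show 11 * a + r + (11 * b + s) = 11 * (a + b) + 10 by omega, hh.carry, if_pos (by omega),
      heq]
    rfl
  · rw [show 11 * a + r + (11 * b + s) = 11 * (a + b + 1) + (r + s - 11) by omega,
      hh.residue _ _ (by omega), if_neg (by omega), add_zero, residueTerm, residueTerm,
      show (r + s + 1) % 11 = (r + s - 11 + 1) % 11 by omega]

lemma sum_row (hh : ElevenRecurrence h) {r : ℕ} (hr : r < 11) (a L : ℕ) (v : ℕ → ZMod 2) :
    ∑ j ∈ range (11 * L), h (11 * a + r + j) * v j =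
      ∑ s ∈ range 11, residueTerm (r + s) * ∑ b ∈ range L, v (11 * b + s) +
        ∑ b ∈ range L, h (a + b) * v (11 * b + (10 - r)) := by
  have hsplit : ∀ s ∈ range 11, ∑ b ∈ range L, h (11 * a + r + (11 * b + s)) * v (11 * b + s) =
      residueTerm (r + s) * ∑ b ∈ range L, v (11 * b + s) +
        if s = 10 - r then ∑ b ∈ range L, h (a + b) * v (11 * b + s) else 0 := by
    intro s hs
    simp only [hh.apply_add hr (Finset.mem_range.1 hs), add_mul, Finset.sum_add_distrib,
      Finset.mul_sum]
    split_ifs <;> simp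
  rw [sum_range_eleven_mul, Finset.sum_congr rfl hsplit, Finset.sum_add_distrib,
    Finset.sum_ite_eq' (range 11) (10 - r), if_pos (Finset.mem_range.2 (by omega))]

lemma block (hh : ElevenRecurrence h) {A B : ℕ} (H : HankelNondeg h A B) {r : ℕ} (hr : r < 11) :
    HankelNondeg h (blockSize A r) (blockSize B (10 - r)) := by
  obtain ⟨b', hb'⟩ : ∃ b', b' = blockSize B (10 - r) := ⟨_, rfl⟩
  rw [← hb']
  intro w hs hw
  let w' : ℕ → ZMod 2 := fun b => if hb : b < b' then w ⟨b, hb⟩ else 0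
  have hw'0 : ∀ b, b' ≤ b → w' b = 0 := fun b hb => dif_neg (by omega)
  have hw'w : ∀ b : Fin b', w' b = w b := fun b => dif_pos b.isLt
  let v : ℕ → ZMod 2 := fun j => if j % 11 = 10 - r then w' (j / 11) else 0
  have hv : ∀ b s, s < 11 → v (11 * b + s) = if s = 10 - r then w' b else 0 := fun b s hs => by
    simp only [v, show (11 * b + s) % 11 = s by omega, show (11 * b + s) / 11 = b by omega]
  have hv0 : ∀ j, B ≤ j → v j = 0 := fun j hj => by
    simp only [v]
    split_ifs with h1
    · refine hw'0 _ (not_lt.1 fun h2 => ?_)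
      rw [hb', lt_blockSize_iff (by omega)] at h2
      omega
    · rfl
  have hb'B : b' ≤ B := by
    rw [hb', blockSize]
    omega
  have hw's : ∑ b ∈ range B, w' b = 0 := by
    rw [← sum_fin_eq_sum_range_of_support hb'B hw'0, ← hs]
    exact Finset.sum_congr rfl fun b _ => hw'w b
  have hσ : ∀ s ∈ range 11, ∑ b ∈ range B, v (11 * b + s) = 0 := by
    intro s hs
    simp only [hv _ s (Finset.mem_range.1 hs)]
    split_ifs
    · exact hw's
    · simp
  have hB : B ≤ 11 * B := by omega
  have hzero : (fun j : Fin B => v j) = 0 := by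
    refine H _ ?_ fun i hi => ?_
    · rw [sum_fin_eq_sum_range_of_support hB hv0, sum_range_eleven_mul]
      exact Finset.sum_eq_zero hσ
    · rw [sum_fin_eq_sum_range_of_support (f := fun j => h (i + j) * v j) hB
        fun j hj => by rw [hv0 j hj, mul_zero]]
      have hrow := hh.sum_row (Nat.mod_lt i (by norm_num : 0 < 11)) (i / 11) B v
      rw [Nat.div_add_mod] at hrow
      rw [hrow, Finset.sum_eq_zero fun s hs => by rw [hσ s hs, mul_zero], zero_add]
      simp only [hv _ (10 - i % 11) (by omega)]
      split_ifs with hir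
      · have hia := hw (i / 11) ((lt_blockSize_iff hr).2 (by omega))
        rw [← hia, ← sum_fin_eq_sum_range_of_support (f := fun b => h (i / 11 + b) * w' b) hb'B
          fun b hb => by rw [hw'0 b hb, mul_zero]]
        exact Finset.sum_congr rfl fun b _ => by rw [hw'w]
      · simp
  funext b
  have hb := (lt_blockSize_iff (by omega)).1 (b.isLt.trans_eq hb')
  have := congrFun hzero ⟨11 * b + (10 - r), hb⟩
  simpa [hv _ (10 - r) (by omega), hw'w] using this

lemma of_blocks (hh : ElevenRecurrence h) {A B m p q : ℕ} (hp : p ≤ 5) (hq : q ≤ p + 1)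
    (hlow : ∀ r < p, blockSize A r = blockSize B (10 - r) + 1 ∧
      HankelNondeg h (blockSize B (10 - r)) (blockSize A r))
    (hmid : ∀ r, p ≤ r → r + q < 11 →
      blockSize A r = m ∧ blockSize B (10 - r) = m ∧ HankelNondeg h m m)
    (hhigh : ∀ r < 11, 11 ≤ r + q → HankelNondeg h (blockSize A r) (blockSize B (10 - r))) :
    HankelNondeg h A B := by
  intro u hus hu
  let v : ℕ → ZMod 2 := fun j => if hj : j < B then u ⟨j, hj⟩ else 0
  have hvu : ∀ j : Fin B, v j = u j := fun j => dif_pos j.isLt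
  have hv0 : ∀ j, B ≤ j → v j = 0 := fun j hj => dif_neg (by omega)
  have hB : B ≤ 11 * B := by omega
  have hbs : ∀ s, blockSize B s ≤ B := fun s => by
    rw [blockSize]
    omega
  have hblock0 : ∀ s < 11, ∀ b, blockSize B s ≤ b → v (11 * b + s) = 0 := fun s hs b hb =>
    hv0 _ (not_lt.1 fun hlt => absurd ((lt_blockSize_iff hs).2 hlt) (not_lt.2 hb))
  let σ : ℕ → ZMod 2 := fun s => ∑ b ∈ range B, v (11 * b + s)
  let κ : ℕ → ZMod 2 := fun r => ∑ s ∈ range 11, residueTerm (r + s) * σ s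
  have hσ : ∑ s ∈ range 11, σ s = 0 := by
    rw [← sum_range_eleven_mul, ← sum_fin_eq_sum_range_of_support hB hv0, ← hus]
    exact Finset.sum_congr rfl fun j _ => hvu j
  let w : ∀ s, Fin (blockSize B s) → ZMod 2 := fun s b => v (11 * b + s)
  have hwσ : ∀ s < 11, ∑ b, w s b = σ s := fun s hs =>
    sum_fin_eq_sum_range_of_support (f := fun b => v (11 * b + s)) (hbs s) (hblock0 s hs)
  have hwκ : ∀ r < 11, ∀ a < blockSize A r,
      ∑ b : Fin (blockSize B (10 - r)), h (a + b) * w (10 - r) b = κ r := by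
    intro r hr a ha
    have hrow := hu _ ((lt_blockSize_iff hr).1 ha)
    simp only [← hvu] at hrow
    rw [sum_fin_eq_sum_range_of_support (f := fun j => h (11 * a + r + j) * v j) hB
      fun j hj => by rw [hv0 j hj, mul_zero], hh.sum_row hr, CharTwo.add_eq_zero] at hrow
    rw [sum_fin_eq_sum_range_of_support (f := fun b => h (a + b) * v (11 * b + (10 - r))) (hbs _)
      fun b hb => by rw [hblock0 _ (by omega) b hb, mul_zero]]
    exact hrow.symm
  obtain ⟨α, β, hαβ, hline⟩ := hankel_solution_line h m
  have hσ0 : ∀ s < 11, σ s = 0 := by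
    refine residue_system_rigid hp hq hαβ σ hσ (fun r hr => ?_) fun r hr hrq => ?_
    · obtain ⟨hsize, hnd⟩ := hlow r hr
      obtain ⟨h1, h2⟩ := hnd.eq_zero_of_transpose hsize (hwκ r (by omega))
      refine ⟨?_, h2⟩
      rw [← hwσ _ (by omega), h1]
      simp
    · obtain ⟨hA, hB', -⟩ := hmid r hr hrq
      rw [← hwσ (10 - r) (by omega)]
      subst hB'
      exact hline _ _ fun i hi => hwκ r (by omega) i (by omega)
  have hκ0 : ∀ r, κ r = 0 := fun r =>
    Finset.sum_eq_zero fun s hs => by rw [hσ0 s (Finset.mem_range.1 hs), mul_zero]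
  have hw0 : ∀ r < 11, w (10 - r) = 0 := by
    intro r hr
    have hnd : r < p ∨ HankelNondeg h (blockSize A r) (blockSize B (10 - r)) := by
      by_cases h1 : r < p
      · exact Or.inl h1
      · by_cases h2 : r + q < 11
        · obtain ⟨hA, hB', hnd⟩ := hmid r (by omega) h2
          right
          rwa [hA, hB']
        · exact Or.inr (hhigh r hr (by omega))
    rcases hnd with h1 | hnd
    · exact ((hlow r h1).2.eq_zero_of_transpose (hlow r h1).1 (hwκ r hr)).1
    · exact hnd _ (by rw [hwσ _ (by omega), hσ0 _ (by omega)]) fun a ha => by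
        rw [hwκ r hr a ha, hκ0]
  funext j
  have hs : 10 - (10 - (j : ℕ) % 11) = j % 11 := by omega
  have hw := hw0 (10 - (j : ℕ) % 11) (by omega)
  rw [hs] at hw
  have hj : (j : ℕ) / 11 < blockSize B (j % 11) := (lt_blockSize_iff (by omega)).2 (by omega)
  have := congrFun hw ⟨_, hj⟩
  simpa only [w, Nat.div_add_mod, hvu, Pi.zero_apply] using this

end ElevenRecurrence

/-- The common shape of `J11` and `K11`. -/
def elevenSet (A B : Set ℕ) : Set ℕ :=
  {t | ∃ n k p : ℕ, p ∈ A ∧ t + 1 = (11 * n + p) * 11 ^ (2 * k)} ∪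
  {t | ∃ n k q : ℕ, q ∈ B ∧ t + 1 = (11 * n + q) * 11 ^ (2 * k + 1)}

lemma mem_elevenSet_of_lt {A B : Set ℕ} (hA : ∀ p ∈ A, 0 < p ∧ p < 11) {c t : ℕ} (ht : t < 10) :
    11 * c + t ∈ elevenSet A B ↔ t + 1 ∈ A := by
  constructor
  · rintro (⟨n, k, p, hp, h⟩ | ⟨n, k, q, hq, h⟩)
    · rcases k with _ | k
      · have := hA p hp
        rwa [show t + 1 = p by omega]
      · rw [mul_add, mul_one, pow_succ, ← mul_assoc] at h
        omega
    · rw [pow_succ, ← mul_assoc] at h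
      omega
  · exact fun h => Or.inl ⟨c, 0, t + 1, h, by ring⟩

lemma mem_elevenSet_carry {A B : Set ℕ} (hA : ∀ p ∈ A, 0 < p ∧ p < 11) {c : ℕ} :
    11 * c + 10 ∈ elevenSet A B ↔ c ∈ elevenSet B A := by
  constructor
  · rintro (⟨n, k, p, hp, h⟩ | ⟨n, k, q, hq, h⟩)
    · rcases k with _ | k
      · have := hA p hp
        omega
      · refine Or.inr ⟨n, k, p, hp, ?_⟩
        rw [show 2 * (k + 1) = 2 * k + 1 + 1 by ring, pow_succ, ← mul_assoc] at h
        omega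
    · refine Or.inl ⟨n, k, q, hq, ?_⟩
      rw [pow_succ, ← mul_assoc] at h
      omega
  · rintro (⟨n, k, p, hp, h⟩ | ⟨n, k, q, hq, h⟩)
    · refine Or.inr ⟨n, k, p, hp, ?_⟩
      rw [pow_succ, ← mul_assoc, ← h]
      ring
    · refine Or.inl ⟨n, k + 1, q, hq, ?_⟩
      rw [show 2 * (k + 1) = 2 * k + 1 + 1 by ring, pow_succ, ← mul_assoc, ← h]
      ring

lemma P11_bounds : ∀ p ∈ P11, 0 < p ∧ p < 11 := by
  rintro p (rfl | rfl | rfl | rfl | rfl) <;> norm_num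

lemma Q11_bounds : ∀ q ∈ Q11, 0 < q ∧ q < 11 := by
  rintro q (rfl | rfl | rfl | rfl | rfl) <;> norm_num

lemma mem_K11_iff (t : ℕ) : t ∈ K11 ↔ t ∉ J11 := by
  change t ∈ elevenSet Q11 P11 ↔ t ∉ elevenSet P11 Q11
  induction t using Nat.strong_induction_on with
  | _ t ih =>
    obtain ⟨c, s, hs, rfl⟩ : ∃ c s, s < 11 ∧ t = 11 * c + s :=
      ⟨t / 11, t % 11, Nat.mod_lt _ (by norm_num), (Nat.div_add_mod t 11).symm⟩
    by_cases h10 : s = 10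
    · subst h10
      rw [mem_elevenSet_carry P11_bounds, mem_elevenSet_carry Q11_bounds, ih c (by omega), not_not]
    · have hs' : s < 10 := by omega
      rw [mem_elevenSet_of_lt P11_bounds hs', mem_elevenSet_of_lt Q11_bounds hs']
      clear ih h10 hs
      interval_cases s <;> simp [P11, Q11]

/-- The indicator function of `J11`, modulo 2. -/
noncomputable def indJ11 : ℕ → ZMod 2 := J11.indicator 1

lemma indicator_K11 (t : ℕ) : (K11.indicator 1 t : ZMod 2) = 1 + indJ11 t := by
  by_cases h : t ∈ J11
  · rw [indJ11, Set.indicator_of_notMem (by rwa [mem_K11_iff, not_not]), Set.indicator_of_mem h]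
    rfl
  · rw [indJ11, Set.indicator_of_mem ((mem_K11_iff t).2 h), Set.indicator_of_notMem h]
    rfl

lemma elevenRecurrence_indJ11 : ElevenRecurrence indJ11 where
  residue c t ht := by
    have h : 11 * c + t ∈ J11 ↔ t + 1 ∈ P11 := mem_elevenSet_of_lt P11_bounds ht
    classical
    rw [indJ11, Set.indicator_apply, h]
    interval_cases t <;> simp [P11, residueTerm]
  carry c := by
    have h : 11 * c + 10 ∈ J11 ↔ c ∈ K11 := mem_elevenSet_carry P11_bounds
    classical
    rw [← indicator_K11, indJ11, Set.indicator_apply, Set.indicator_apply, h,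
      Pi.one_apply, Pi.one_apply]

lemma hankelNondeg_indicator_K11 (a b : ℕ) :
    HankelNondeg (K11.indicator 1) a b ↔ HankelNondeg indJ11 a b := by
  refine forall_congr' fun v => forall_congr' fun hv => ?_
  simp only [indicator_K11, add_mul, one_mul, Finset.sum_add_distrib, hv, zero_add]

lemma odd_iff_cast_ne_zero {n : ℕ} : Odd n ↔ (n : ZMod 2) ≠ 0 := by
  rw [← Nat.not_even_iff_odd, Ne, ZMod.natCast_eq_zero_iff_even]

lemma odd_add_mul_add_iff (S : Set ℕ) (n : ℕ) {x y : ℕ}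
    (hx : x = ∑ i ∈ range n, permCount S n i) (hy : y = permCount S n n) :
    Odd (x + x * y + y) ↔ HankelNondeg (S.indicator 1) n n := by
  rw [hankelNondeg_self_iff, hx, hy]
  simp only [← permCount_cast, ← Nat.cast_sum]
  rw [ZMod.natCast_eq_zero_iff_even, ZMod.natCast_eq_zero_iff_even, ← Nat.not_even_iff_odd,
    not_iff_not]
  simp only [Nat.even_add, Nat.even_mul]
  tauto

lemma odd_T_iff (n : ℕ) : Odd (T n) ↔ HankelNondeg indJ11 n n :=
  odd_add_mul_add_iff J11 n rfl rfl

lemma odd_R_iff (n : ℕ) : Odd (R n) ↔ HankelNondeg indJ11 n n :=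
  (odd_add_mul_add_iff K11 n rfl rfl).trans (hankelNondeg_indicator_K11 n n)

lemma odd_Z_iff {n : ℕ} (hn : 1 ≤ n) : Odd (Z n) ↔ HankelNondeg indJ11 (n - 1) n := by
  rw [odd_iff_cast_ne_zero, Z, permCount_cast, hankelNondeg_pred_iff _ hn]
  rfl

lemma odd_W_iff {n : ℕ} (hn : 1 ≤ n) : Odd (W n) ↔ HankelNondeg indJ11 (n - 1) n := by
  rw [odd_iff_cast_ne_zero, W, permCount_cast, ← hankelNondeg_indicator_K11,
    hankelNondeg_pred_iff _ hn]

lemma modEq_two_of_odd_iff {a b : ℕ} (h : Odd a ↔ Odd b) : a ≡ b [MOD 2] := by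
  rw [Nat.odd_iff, Nat.odd_iff] at h
  unfold Nat.ModEq
  omega

namespace ElevenRecurrence

variable {h : ℕ → ZMod 2}

lemma block_of_eq (hh : ElevenRecurrence h) {A B a b : ℕ} (H : HankelNondeg h A B) (r : ℕ)
    (hr : r < 11) (ha : blockSize A r = a) (hb : blockSize B (10 - r) = b) :
    HankelNondeg h a b := by
  subst ha hb
  exact hh.block H hr

/-- Nondegeneracy of a system whose first `p` blocks of rows have shape `(y + 1) × y`, whose last
`q` blocks have shape `y × (y + 1)` and whose other blocks have shape `m × m`. -/
lemma hankelNondeg_iff (hh : ElevenRecurrence h) {A B : ℕ} (m y z p q : ℕ) (hyz : z = y + 1)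
    (hp : p ≤ 5) (hpq : p ≤ q) (hq : q ≤ p + 1)
    (hlow : ∀ r < p, blockSize A r = z ∧ blockSize B (10 - r) = y)
    (hmid : ∀ r, p ≤ r → r + q < 11 → blockSize A r = m ∧ blockSize B (10 - r) = m)
    (hhigh : ∀ r < 11, 11 ≤ r + q → blockSize A r = y ∧ blockSize B (10 - r) = z) :
    HankelNondeg h A B ↔
      (p + q < 11 → HankelNondeg h m m) ∧ (0 < q → HankelNondeg h y z) := by
  refine ⟨fun H => ⟨fun hpq => ?_, fun hq0 => ?_⟩, fun ⟨Hm, Hz⟩ => ?_⟩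
  · exact hh.block_of_eq H p (by omega) (hmid p le_rfl hpq).1 (hmid p le_rfl hpq).2
  · exact hh.block_of_eq H 10 (by omega) (hhigh 10 (by omega) (by omega)).1
      (hhigh 10 (by omega) (by omega)).2
  · refine hh.of_blocks (m := m) hp hq (fun r hr => ?_) (fun r hr hrq => ?_) fun r hr hrq => ?_
    · rw [(hlow r hr).1, (hlow r hr).2]
      exact ⟨hyz, Hz (by omega)⟩
    · exact ⟨(hmid r hr hrq).1, (hmid r hr hrq).2, Hm (by omega)⟩
    · rw [(hhigh r hr hrq).1, (hhigh r hr hrq).2]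
      exact Hz (by omega)

lemma self_mul (hh : ElevenRecurrence h) (n : ℕ) :
    HankelNondeg h (11 * n) (11 * n) ↔ HankelNondeg h n n := by
  rw [hh.hankelNondeg_iff n 0 1 0 0 rfl (by omega) (by omega) (by omega)]
  · simp
  all_goals
    unfold blockSize
    intros
    omega

lemma self_mul_add_low (hh : ElevenRecurrence h) (n : ℕ) {i : ℕ} (h1 : 1 ≤ i) (h5 : i ≤ 5) :
    HankelNondeg h (11 * n + i) (11 * n + i) ↔
      HankelNondeg h n n ∧ HankelNondeg h n (n + 1) := by
  rw [hh.hankelNondeg_iff n n (n + 1) i i rfl (by omega) (by omega) (by omega)]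
  · simp [show i + i < 11 by omega, show 0 < i by omega]
  all_goals
    unfold blockSize
    intros
    omega

lemma self_mul_add_high (hh : ElevenRecurrence h) (n : ℕ) {i : ℕ} (h6 : 6 ≤ i) (h10 : i ≤ 10) :
    HankelNondeg h (11 * n + i) (11 * n + i) ↔
      HankelNondeg h (n + 1) (n + 1) ∧ HankelNondeg h n (n + 1) := by
  rw [hh.hankelNondeg_iff (n + 1) n (n + 1) (11 - i) (11 - i) rfl (by omega) (by omega) (by omega)]
  · simp [show 11 - i + (11 - i) < 11 by omega, show i < 11 by omega]
  all_goals
    unfold blockSize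
    intros
    omega

lemma pred_mul (hh : ElevenRecurrence h) {n : ℕ} (hn : 1 ≤ n) :
    HankelNondeg h (11 * n - 1) (11 * n) ↔ HankelNondeg h n n ∧ HankelNondeg h (n - 1) n := by
  rw [hh.hankelNondeg_iff n (n - 1) n 0 1 (by omega) (by omega) (by omega) (by omega)]
  · simp
  all_goals
    unfold blockSize
    intros
    omega

lemma pred_mul_add_low (hh : ElevenRecurrence h) (n : ℕ) {i : ℕ} (h1 : 1 ≤ i) (h5 : i ≤ 5) :
    HankelNondeg h (11 * n + i - 1) (11 * n + i) ↔
      HankelNondeg h n n ∧ HankelNondeg h n (n + 1) := by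
  rw [hh.hankelNondeg_iff n n (n + 1) (i - 1) i rfl (by omega) (by omega) (by omega)]
  · simp [show i - 1 + i < 11 by omega, show 0 < i by omega]
  all_goals
    unfold blockSize
    intros
    omega

lemma pred_mul_add_six (hh : ElevenRecurrence h) (n : ℕ) :
    HankelNondeg h (11 * n + 6 - 1) (11 * n + 6) ↔ HankelNondeg h n (n + 1) := by
  rw [hh.hankelNondeg_iff n n (n + 1) 5 6 rfl (by omega) (by omega) (by omega)]
  · simp
  all_goals
    unfold blockSize
    intros
    omega

lemma pred_mul_add_high (hh : ElevenRecurrence h) (n : ℕ) {i : ℕ} (h7 : 7 ≤ i) (h10 : i ≤ 10) :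
    HankelNondeg h (11 * n + i - 1) (11 * n + i) ↔
      HankelNondeg h (n + 1) (n + 1) ∧ HankelNondeg h n (n + 1) := by
  rw [hh.hankelNondeg_iff (n + 1) n (n + 1) (11 - i) (12 - i) rfl (by omega) (by omega) (by omega)]
  · simp [show 11 - i + (12 - i) < 11 by omega, show i < 12 by omega]
  all_goals
    unfold blockSize
    intros
    omega

end ElevenRecurrence

/-- Simplified recurrences mod 2 for `T, R, Z, W` (case `d = 11`). -/
theorem F11_recurrences_TRZW :
    ∀ n : ℕ, 1 ≤ n →
      T (11 * n) ≡ R n [MOD 2] ∧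
      R (11 * n) ≡ T n [MOD 2] ∧
      (∀ i : ℕ, 1 ≤ i → i ≤ 5 →
        T (11 * n + i) ≡ R n * W (n + 1) [MOD 2] ∧
        R (11 * n + i) ≡ T n * Z (n + 1) [MOD 2]) ∧
      (∀ i : ℕ, 6 ≤ i → i ≤ 10 →
        T (11 * n + i) ≡ R (n + 1) * W (n + 1) [MOD 2] ∧
        R (11 * n + i) ≡ T (n + 1) * Z (n + 1) [MOD 2]) ∧
      Z (11 * n) ≡ R n * W n [MOD 2] ∧
      W (11 * n) ≡ T n * Z n [MOD 2] ∧
      (∀ i : ℕ, 1 ≤ i → i ≤ 5 →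
        Z (11 * n + i) ≡ R n * W (n + 1) [MOD 2] ∧
        W (11 * n + i) ≡ T n * Z (n + 1) [MOD 2]) ∧
      Z (11 * n + 6) ≡ W (n + 1) [MOD 2] ∧
      W (11 * n + 6) ≡ Z (n + 1) [MOD 2] ∧
      (∀ i : ℕ, 7 ≤ i → i ≤ 10 →
        Z (11 * n + i) ≡ R (n + 1) * W (n + 1) [MOD 2] ∧
        W (11 * n + i) ≡ T (n + 1) * Z (n + 1) [MOD 2]) := by
  have hJ := elevenRecurrence_indJ11
  intro n hn
  refine ⟨?_, ?_, fun i h1 h5 => ⟨?_, ?_⟩, fun i h6 h10 => ⟨?_, ?_⟩, ?_, ?_,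
    fun i h1 h5 => ⟨?_, ?_⟩, ?_, ?_, fun i h7 h10 => ⟨?_, ?_⟩⟩ <;>
  · refine modEq_two_of_odd_iff ?_
    simp (discharger := omega) only [Nat.odd_mul, odd_T_iff, odd_R_iff, odd_Z_iff, odd_W_iff,
      Nat.add_sub_cancel, hJ.self_mul, hJ.self_mul_add_low, hJ.self_mul_add_high, hJ.pred_mul,
      hJ.pred_mul_add_low, hJ.pred_mul_add_six, hJ.pred_mul_add_high]
end
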